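/- arXiv:1609.04596 — 5 statements merged into one kernel-verified Lean document; each statement's English description precedes it below -/
import Mathlib

section
/- Let m ≥ 1, θ ≥ 2, λ ∈ ℝ, and let f : ℝ^m → ℝ be locally Lipschitz continuous and coercive. Let φ be a bounded-from-below C² subsolution and ψ a bounded-from-below C² supersolution of (EP)_λ. Then there exists R > 0, depending only on f and λ, with the following property: if φ(y) ≤ ψ(y) for all y with |y| = R (equivalently, if z₁ = −e^{−φ} ≤ z₂ = −e^{−ψ} on ∂B_R), then φ(y) ≤ ψ(y) for all y with |y| ≥ R. -/
open Filter

noncomputable def lap {m : ℕ} (φ : EuclideanSpace ℝ (Fin m) → ℝ)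
    (y : EuclideanSpace ℝ (Fin m)) : ℝ :=
  ∑ i : Fin m, iteratedFDeriv ℝ 2 φ y ![EuclideanSpace.single i 1, EuclideanSpace.single i 1]

def IsSubsolution {m : ℕ} (θ : ℝ) (f : EuclideanSpace ℝ (Fin m) → ℝ) (lam : ℝ)
    (φ : EuclideanSpace ℝ (Fin m) → ℝ) : Prop :=
  ContDiff ℝ 2 φ ∧
    ∀ y, -(1/2) * lap φ y + (1/θ) * ‖gradient φ y‖ ^ θ ≤ f y - lam

def IsSupersolution {m : ℕ} (θ : ℝ) (f : EuclideanSpace ℝ (Fin m) → ℝ) (lam : ℝ)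
    (φ : EuclideanSpace ℝ (Fin m) → ℝ) : Prop :=
  ContDiff ℝ 2 φ ∧
    ∀ y, -(1/2) * lap φ y + (1/θ) * ‖gradient φ y‖ ^ θ ≥ f y - lam

def IsSolution {m : ℕ} (θ : ℝ) (f : EuclideanSpace ℝ (Fin m) → ℝ) (lam : ℝ)
    (φ : EuclideanSpace ℝ (Fin m) → ℝ) : Prop :=
  ContDiff ℝ 2 φ ∧
    ∀ y, -(1/2) * lap φ y + (1/θ) * ‖gradient φ y‖ ^ θ = f y - lam

noncomputable def lambdaStar {m : ℕ} (θ : ℝ) (f : EuclideanSpace ℝ (Fin m) → ℝ) : ℝ :=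
  sSup {lam : ℝ | ∃ φ, IsSubsolution θ f lam φ}

def H0 {m : ℕ} (f : EuclideanSpace ℝ (Fin m) → ℝ) (α f₀ : ℝ) : Prop :=
  LocallyLipschitz f ∧ BddBelow (Set.range f) ∧
    ∀ y, DifferentiableAt ℝ f y →
      (1 ≤ α → ‖gradient f y‖ ≤ f₀ * (1 + ‖y‖ ^ (α - 1))) ∧
      (α < 1 → ‖gradient f y‖ ≤ f₀)

def H1 {m : ℕ} (f : EuclideanSpace ℝ (Fin m) → ℝ) (α f₀ : ℝ) : Prop :=
  ∀ y, f₀⁻¹ * (‖y‖ ^ α + 1) ≤ f y ∧ f y ≤ f₀ * (‖y‖ ^ α + 1)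

def MemPhi {m : ℕ} (γ : ℝ) (v : EuclideanSpace ℝ (Fin m) → ℝ) : Prop :=
  ContDiff ℝ 2 v ∧ ∃ c > 1, ∀ y, c⁻¹ * ‖y‖ ^ γ - c ≤ v y ∧ v y ≤ c * (1 + ‖y‖ ^ γ)

def Coercive {m : ℕ} (f : EuclideanSpace ℝ (Fin m) → ℝ) : Prop :=
  Tendsto f (cocompact (EuclideanSpace ℝ (Fin m))) atTop


lemma second_order (g g1 : ℝ → ℝ) (c : ℝ) (hg : ∀ τ, HasDerivAt g (g1 τ) τ)
    (hg1 : HasDerivAt g1 c 0) (hmax : IsLocalMax g 0) : g1 0 = 0 ∧ c ≤ 0 := by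
  have h0 : g1 0 = 0 := hmax.hasDerivAt_eq_zero (hg 0)
  refine ⟨h0, ?_⟩
  by_contra hc
  push Not at hc
  have hd : deriv g = g1 := funext fun τ => (hg τ).deriv
  have hmin : IsLocalMin g 0 := by
    apply isLocalMin_of_deriv_deriv_pos
    · rw [hd, hg1.deriv]; exact hc
    · rw [hd, h0]
    · exact (hg 0).continuousAt
  have hconst : g =ᶠ[nhds 0] fun _ => g 0 := by
    filter_upwards [hmax, hmin] with x h1 h2
    exact le_antisymm h1 h2
  have h1 : deriv g =ᶠ[nhds 0] deriv (fun _ : ℝ => g 0) := hconst.deriv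
  rw [hd] at h1
  have h2 := h1.deriv_eq
  rw [hg1.deriv] at h2
  simp at h2
  linarith

lemma line_deriv {m : ℕ} {φ : EuclideanSpace ℝ (Fin m) → ℝ} (hφ : ContDiff ℝ 2 φ)
    (y v : EuclideanSpace ℝ (Fin m)) :
    (∀ τ : ℝ, HasDerivAt (fun τ : ℝ => φ (y + τ • v)) (fderiv ℝ φ (y + τ • v) v) τ) ∧
    HasDerivAt (fun τ : ℝ => fderiv ℝ φ (y + τ • v) v) (iteratedFDeriv ℝ 2 φ y ![v, v]) 0 := by
  have hl : ∀ τ : ℝ, HasDerivAt (fun τ : ℝ => y + τ • v) v τ := fun τ => by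
    simpa using ((hasDerivAt_id τ).smul_const v).const_add y
  constructor
  · intro τ
    have h := (hφ.differentiable (by norm_num) (y + τ • v)).hasFDerivAt
    exact h.comp_hasDerivAt τ (hl τ)
  · have h1 : ContDiff ℝ 1 (fderiv ℝ φ) := hφ.fderiv_right (by norm_num)
    have h2 : HasFDerivAt (fderiv ℝ φ) (fderiv ℝ (fderiv ℝ φ) y) (y + (0:ℝ) • v) := by
      simpa using (h1.differentiable (by norm_num) y).hasFDerivAt
    have h3 := h2.comp_hasDerivAt (0:ℝ) (hl 0)
    have h4 := h3.clm_apply (hasDerivAt_const (0:ℝ) v)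
    rw [iteratedFDeriv_two_apply]
    simpa using h4

lemma grad_comp {m : ℕ} (φ : EuclideanSpace ℝ (Fin m) → ℝ) (y : EuclideanSpace ℝ (Fin m))
    (i : Fin m) : gradient φ y i = fderiv ℝ φ y (EuclideanSpace.single i 1) := by
  have : inner ℝ (gradient φ y) (EuclideanSpace.single i (1:ℝ)) =
      fderiv ℝ φ y (EuclideanSpace.single i 1) := by
    rw [gradient, InnerProductSpace.toDual_symm_apply]
  rw [← this, EuclideanSpace.inner_single_right]
  simp

lemma grad_normsq {m : ℕ} (φ : EuclideanSpace ℝ (Fin m) → ℝ) (y : EuclideanSpace ℝ (Fin m)) :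
    ‖gradient φ y‖ ^ 2 = ∑ i, (fderiv ℝ φ y (EuclideanSpace.single i 1)) ^ 2 := by
  rw [EuclideanSpace.norm_sq_eq]
  simp only [grad_comp, Real.norm_eq_abs, sq_abs]

lemma line_max {m : ℕ} {u : EuclideanSpace ℝ (Fin m) → ℝ} {y : EuclideanSpace ℝ (Fin m)}
    (h : IsLocalMax u y) (v : EuclideanSpace ℝ (Fin m)) :
    IsLocalMax (fun τ : ℝ => u (y + τ • v)) 0 := by
  have hc : ContinuousAt (fun τ : ℝ => y + τ • v) 0 := by fun_prop
  have h' : IsLocalMax u ((fun τ : ℝ => y + τ • v) 0) := by simpa using h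
  exact IsLocalMax.comp_continuous (g := fun τ : ℝ => y + τ • v) h' hc

/-- The algebraic heart. -/
lemma key_ineq (θ t s : ℝ) (hθ : 2 ≤ θ) (ht : 1 < t) (hs : 0 ≤ s) :
    -(t - 1) / 2 ≤ ((t * s) ^ θ / θ - (t * s) ^ 2 / 2) - t * (s ^ θ / θ - s ^ 2 / 2) := by
  have ht0 : 0 < t := by linarith
  have hmul : (t * s) ^ θ = t ^ θ * s ^ θ := Real.mul_rpow ht0.le hs
  have hb1 : 1 + (θ - 1) * (t - 1) ≤ t ^ (θ - 1) := by
    have := one_add_mul_self_le_rpow_one_add (s := t - 1) (by linarith) (p := θ - 1) (by linarith)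
    simpa using this
  have htθ : t ^ θ = t * t ^ (θ - 1) := by
    rw [Real.rpow_sub_one ht0.ne']; field_simp
  have hsθ : 0 ≤ s ^ θ := Real.rpow_nonneg hs _
  rw [hmul, htθ]
  by_cases hc : s ^ 2 * t ≤ 1
  · have h1 : 0 ≤ t * (t ^ (θ - 1) - 1) * s ^ θ / θ := by
      have : 0 ≤ t ^ (θ - 1) - 1 := by nlinarith
      positivity
    have h2 : t * t ^ (θ - 1) * s ^ θ / θ = t * (t ^ (θ - 1) - 1) * s ^ θ / θ + t * (s ^ θ / θ) := by
      ring
    rw [h2]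
    nlinarith
  · push Not at hc
    have hs0 : 0 < s := by
      rcases hs.lt_or_eq with h | h
      · exact h
      · subst h; norm_num at hc
    set a := (θ - 2) / 2 with ha
    have ha0 : 0 ≤ a := by rw [ha]; linarith
    have hta : 1 ≤ t ^ a := Real.one_le_rpow ht.le ha0
    have hb2 : 1 + (a + 1) * (t - 1) ≤ t ^ (a + 1) := by
      have := one_add_mul_self_le_rpow_one_add (s := t - 1) (by linarith) (p := a + 1) (by linarith)
      simpa using this
    have hsp : t ^ (θ - 1) = t ^ a * t ^ (a + 1) := by
      rw [← Real.rpow_add ht0]; congr 1; rw [ha]; ring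
    have hA : (a + 1) * (t - 1) * t ^ a ≤ t ^ (θ - 1) - 1 := by
      rw [hsp]; nlinarith
    have hsa : 1 ≤ t ^ a * s ^ (θ - 2) := by
      have h1 : s ^ (θ - 2) = (s ^ 2) ^ a := by
        rw [← Real.rpow_natCast, ← Real.rpow_mul hs]; congr 1; rw [ha]; push_cast; ring
      rw [h1, ← Real.mul_rpow ht0.le (by positivity)]
      exact Real.one_le_rpow (by linarith) ha0
    have hss : s ^ θ = s ^ 2 * s ^ (θ - 2) := by
      rw [← Real.rpow_natCast, ← Real.rpow_add hs0]; congr 1; push_cast; ring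
    have hθa : θ = 2 * (a + 1) := by rw [ha]; ring
    have hB : (t - 1) * s ^ 2 / 2 ≤ (t ^ (θ - 1) - 1) * s ^ θ / θ := by
      rw [div_le_div_iff₀ (by norm_num) (by linarith)]
      have e1 : (a + 1) * (t - 1) * t ^ a * s ^ θ ≤ (t ^ (θ - 1) - 1) * s ^ θ :=
        mul_le_mul_of_nonneg_right hA hsθ
      have e2 : (a + 1) * (t - 1) * s ^ 2 * 1 ≤
          (a + 1) * (t - 1) * s ^ 2 * (t ^ a * s ^ (θ - 2)) := by
        apply mul_le_mul_of_nonneg_left hsa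
        have : 0 ≤ t - 1 := by linarith
        positivity
      have e3 : (a + 1) * (t - 1) * s ^ 2 * (t ^ a * s ^ (θ - 2)) =
          (a + 1) * (t - 1) * t ^ a * s ^ θ := by rw [hss]; ring
      have e4 : (t - 1) * s ^ 2 * θ = 2 * ((a + 1) * (t - 1) * s ^ 2) := by rw [hθa]; ring
      linarith
    have h2 : t * t ^ (θ - 1) * s ^ θ / θ =
        t * ((t ^ (θ - 1) - 1) * s ^ θ / θ) + t * (s ^ θ / θ) := by
      ring
    rw [h2]
    nlinarith [mul_le_mul_of_nonneg_left hB ht0.le]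

lemma super_lower {m : ℕ} (θ lam : ℝ) (hθ : 2 ≤ θ)
    (f ψ : EuclideanSpace ℝ (Fin m) → ℝ) (hψ : IsSupersolution θ f lam ψ) (c A : ℝ)
    (hc : ∀ y, c ≤ ψ y) (hA : 0 ≤ A) (y0 : EuclideanSpace ℝ (Fin m))
    (hf : ∀ y, ‖y - y0‖ ≤ 1 → A * m + (1 / θ) * (2 * A) ^ θ < f y - lam) :
    c + A ≤ ψ y0 := by
  by_contra hlt
  push Not at hlt
  obtain ⟨hC, hS⟩ := hψ
  set u : EuclideanSpace ℝ (Fin m) → ℝ := fun y => A * (1 - ‖y - y0‖ ^ 2) - ψ y with hu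
  have hcont : Continuous u := by
    have := hC.continuous
    fun_prop
  obtain ⟨x, hx, hmax⟩ := (isCompact_closedBall y0 (1:ℝ)).exists_isMaxOn
    ⟨y0, by simp⟩ hcont.continuousOn
  have hx1 : ‖x - y0‖ ≤ 1 := by simpa [dist_eq_norm] using hx
  have h0 : u y0 ≤ u x := hmax (by simp)
  have hx2 : ‖x - y0‖ < 1 := by
    rcases hx1.lt_or_eq with h | h
    · exact h
    · simp only [hu, h] at h0
      simp at h0
      linarith [hc x]
  have hloc : IsLocalMax u x :=
    hmax.isLocalMax (mem_of_superset (Metric.isOpen_ball.mem_nhds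
      (by simpa [dist_eq_norm] using hx2)) Metric.ball_subset_closedBall)
  have key : ∀ i : Fin m, fderiv ℝ ψ x (EuclideanSpace.single i 1) = - (2 * A * (x - y0) i) ∧
      -2 * A ≤ iteratedFDeriv ℝ 2 ψ x ![EuclideanSpace.single i 1, EuclideanSpace.single i 1] := by
    intro i
    set v : EuclideanSpace ℝ (Fin m) := EuclideanSpace.single i 1 with hv
    obtain ⟨d1, d2⟩ := line_deriv hC x v
    have hnorm : ∀ τ : ℝ, ‖x + τ • v - y0‖ ^ 2 = ‖x - y0‖ ^ 2 + 2 * τ * (x - y0) i + τ ^ 2 := by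
      intro τ
      have : x + τ • v - y0 = (x - y0) + τ • v := by abel
      rw [this, norm_add_sq_real, inner_smul_right, norm_smul, hv]
      simp [EuclideanSpace.inner_single_right]
      ring
    have hm := line_max hloc v
    have hfun : (fun τ : ℝ => u (x + τ • v)) = fun τ =>
        A * (1 - (‖x - y0‖ ^ 2 + 2 * τ * (x - y0) i + τ ^ 2)) - ψ (x + τ • v) := by
      funext τ; simp only [hu, hnorm]
    rw [hfun] at hm
    have hp : ∀ τ : ℝ, HasDerivAt (fun τ : ℝ =>
        A * (1 - (‖x - y0‖ ^ 2 + 2 * τ * (x - y0) i + τ ^ 2)))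
        (-(A * (2 * (x - y0) i + 2 * τ))) τ := by
      intro τ
      have h1 : HasDerivAt (fun τ : ℝ => 2 * τ * (x - y0) i) (2 * (x - y0) i) τ := by
        simpa using ((hasDerivAt_id τ).const_mul 2).mul_const ((x - y0) i)
      have h2 : HasDerivAt (fun τ : ℝ => τ ^ 2) (2 * τ) τ := by
        simpa using hasDerivAt_pow 2 τ
      have h3 := ((((h1.const_add (‖x - y0‖ ^ 2)).add h2).const_sub 1).const_mul A)
      exact h3.congr_deriv (by ring)
    have hp2 : HasDerivAt (fun τ : ℝ => -(A * (2 * (x - y0) i + 2 * τ))) (-(A * 2)) 0 := by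
      have := ((((hasDerivAt_id (0:ℝ)).const_mul 2).const_add (2 * (x - y0) i)).const_mul A).neg
      exact this.congr_deriv (by ring)
    obtain ⟨e1, e2⟩ := second_order _ _ _ (fun τ => (hp τ).sub (d1 τ)) (hp2.sub d2) hm
    simp at e1
    constructor
    · simp; linarith
    · linarith
  have hlap : -2 * A * m ≤ lap ψ x := by
    have : ∑ i : Fin m, (-2 * A) ≤ lap ψ x := Finset.sum_le_sum fun i _ => (key i).2
    simp at this
    linarith
  have hgrad : gradient ψ x = (-(2 * A)) • (x - y0) := by
    ext i
    rw [grad_comp, (key i).1]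
    simp
  have hng : ‖gradient ψ x‖ ≤ 2 * A := by
    rw [hgrad, norm_smul, Real.norm_eq_abs, abs_neg, abs_of_nonneg (by positivity)]
    nlinarith
  have hpow : ‖gradient ψ x‖ ^ θ ≤ (2 * A) ^ θ :=
    Real.rpow_le_rpow (norm_nonneg _) hng (by linarith)
  have h1 := hS x
  have h2 := hf x hx1
  have h3 : (1 / θ) * ‖gradient ψ x‖ ^ θ ≤ (1 / θ) * (2 * A) ^ θ :=
    mul_le_mul_of_nonneg_left hpow (by positivity)
  nlinarith

lemma coercive_radius {m : ℕ} {f : EuclideanSpace ℝ (Fin m) → ℝ} (hcoer : Coercive f) (K : ℝ) :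
    ∃ R > (0:ℝ), ∀ y, R ≤ ‖y‖ → K < f y := by
  have h := hcoer.eventually_gt_atTop K
  rw [← Metric.cobounded_eq_cocompact, ← comap_norm_atTop, eventually_comap,
    eventually_atTop] at h
  obtain ⟨R, hR⟩ := h
  refine ⟨max R 1, by positivity, fun y hy => hR ‖y‖ (le_trans (le_max_left _ _) hy) y rfl⟩

theorem stmt8 (m : ℕ) (hm : 1 ≤ m) (θ lam : ℝ) (hθ : 2 ≤ θ)
    (f : EuclideanSpace ℝ (Fin m) → ℝ) (hf : LocallyLipschitz f) (hcoer : Coercive f) :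
    ∃ R > (0 : ℝ), ∀ φ ψ : EuclideanSpace ℝ (Fin m) → ℝ,
      IsSubsolution θ f lam φ → BddBelow (Set.range φ) →
      IsSupersolution θ f lam ψ → BddBelow (Set.range ψ) →
      (∀ y, ‖y‖ = R → φ y ≤ ψ y) →
      ∀ y, R ≤ ‖y‖ → φ y ≤ ψ y := by
  obtain ⟨R, hR0, hR⟩ := coercive_radius hcoer (lam + 1 / 2)
  refine ⟨R, hR0, fun φ ψ hφ _ hψ hψb hbd y0 hy0 => ?_⟩
  by_contra hlt
  push Not at hlt
  obtain ⟨c, hc⟩ := hψb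
  have hc' : ∀ y, c ≤ ψ y := fun y => hc ⟨y, rfl⟩
  set u : EuclideanSpace ℝ (Fin m) → ℝ := fun y => Real.exp (-ψ y) - Real.exp (-φ y) with hu
  have hδ : 0 < u y0 := by
    simp only [hu, sub_pos, Real.exp_lt_exp]; linarith
  set A := max 0 (-Real.log (u y0) - c) with hAdef
  have hA0 : 0 ≤ A := le_max_left _ _
  obtain ⟨ρ, hρ0, hρ⟩ := coercive_radius hcoer (lam + (A * m + (1 / θ) * (2 * A) ^ θ))
  have hfar : ∀ y, ρ + 1 ≤ ‖y‖ → u y < u y0 := by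
    intro y hy
    have h1 : c + A ≤ ψ y := by
      apply super_lower θ lam hθ f ψ hψ c A hc' hA0 y
      intro z hz
      have : ρ ≤ ‖z‖ := by
        have := norm_sub_norm_le y z
        rw [norm_sub_rev] at this
        linarith
      linarith [hρ z this]
    have h2 : -Real.log (u y0) - c ≤ A := le_max_right _ _
    have h3 : Real.exp (-ψ y) ≤ u y0 := by
      rw [← Real.exp_log hδ, Real.exp_le_exp]
      linarith
    have := Real.exp_pos (-φ y)
    simp only [hu] at h3 ⊢
    linarith
  obtain ⟨hφC, hφS⟩ := hφ
  obtain ⟨hψC, hψS⟩ := hψ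
  have hcont : Continuous u := by
    have := hφC.continuous
    have := hψC.continuous
    fun_prop
  set S : Set (EuclideanSpace ℝ (Fin m)) := {y | R ≤ ‖y‖ ∧ ‖y‖ ≤ ρ + 1} with hS
  have hScomp : IsCompact S := by
    apply (isCompact_closedBall (0 : EuclideanSpace ℝ (Fin m)) (ρ + 1)).of_isClosed_subset
    · exact (isClosed_le continuous_const continuous_norm).inter
        (isClosed_le continuous_norm continuous_const)
    · intro y hy; simpa using hy.2
  have hy0S : y0 ∈ S := by
    refine ⟨hy0, ?_⟩
    by_contra h
    push Not at h
    exact lt_irrefl _ (hfar y0 h.le)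
  obtain ⟨x, hx, hmax⟩ := hScomp.exists_isMaxOn ⟨y0, hy0S⟩ hcont.continuousOn
  have hux : u y0 ≤ u x := hmax hy0S
  have hw : φ x > ψ x := by
    have : 0 < u x := by linarith
    simp only [hu, sub_pos, Real.exp_lt_exp] at this
    linarith
  have hx1 : R < ‖x‖ := lt_of_le_of_ne hx.1 fun h => by linarith [hbd x h.symm]
  have hx2 : ‖x‖ < ρ + 1 := by
    by_contra h
    push Not at h
    linarith [hfar x h]
  have hloc : IsLocalMax u x := by
    apply hmax.isLocalMax
    have hop : IsOpen {y : EuclideanSpace ℝ (Fin m) | R < ‖y‖ ∧ ‖y‖ < ρ + 1} :=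
      (isOpen_lt continuous_const continuous_norm).inter
        (isOpen_lt continuous_norm continuous_const)
    exact mem_of_superset (hop.mem_nhds ⟨hx1, hx2⟩) fun y hy => ⟨hy.1.le, hy.2.le⟩
  set w1 := Real.exp (-φ x) with hw1
  set w2 := Real.exp (-ψ x) with hw2
  have hw1p : 0 < w1 := Real.exp_pos _
  have hw2p : 0 < w2 := Real.exp_pos _
  have hww : w1 < w2 := by rw [hw1, hw2, Real.exp_lt_exp]; linarith
  have key : ∀ i : Fin m,
      w1 * fderiv ℝ φ x (EuclideanSpace.single i 1) =
        w2 * fderiv ℝ ψ x (EuclideanSpace.single i 1) ∧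
      w1 * (iteratedFDeriv ℝ 2 φ x ![EuclideanSpace.single i 1, EuclideanSpace.single i 1]
        - (fderiv ℝ φ x (EuclideanSpace.single i 1)) ^ 2) ≤
      w2 * (iteratedFDeriv ℝ 2 ψ x ![EuclideanSpace.single i 1, EuclideanSpace.single i 1]
        - (fderiv ℝ ψ x (EuclideanSpace.single i 1)) ^ 2) := by
    intro i
    set v : EuclideanSpace ℝ (Fin m) := EuclideanSpace.single i 1 with hv
    obtain ⟨a1, a2⟩ := line_deriv hφC x v
    obtain ⟨b1, b2⟩ := line_deriv hψC x v
    have hm := line_max hloc v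
    have ea := fun τ => (a1 τ).neg.exp
    have eb := fun τ => (b1 τ).neg.exp
    have ea2 := (ea 0).mul a2.neg
    have eb2 := (eb 0).mul b2.neg
    obtain ⟨e1, e2⟩ := second_order _ _ _ (fun τ => (eb τ).sub (ea τ)) (eb2.sub ea2) hm
    simp only [Pi.neg_apply, zero_smul, add_zero, ← hw1, ← hw2] at e1 e2
    constructor
    · linarith
    · nlinarith
  set s1 := ‖gradient φ x‖ with hs1
  set s2 := ‖gradient ψ x‖ with hs2
  have hgrad : w1 * s1 = w2 * s2 := by
    have : w1 • gradient φ x = w2 • gradient ψ x := by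
      ext i
      have := (key i).1
      simpa [grad_comp] using this
    have := congrArg norm this
    rw [norm_smul, norm_smul, Real.norm_of_nonneg hw1p.le, Real.norm_of_nonneg hw2p.le] at this
    exact this
  have hlap : w1 * (lap φ x - s1 ^ 2) ≤ w2 * (lap ψ x - s2 ^ 2) := by
    rw [hs1, hs2, grad_normsq, grad_normsq, lap, lap, ← Finset.sum_sub_distrib,
      ← Finset.sum_sub_distrib, Finset.mul_sum, Finset.mul_sum]
    exact Finset.sum_le_sum fun i _ => (key i).2
  have h1 := mul_le_mul_of_nonneg_left (hφS x) hw1p.le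
  have h2 := mul_le_mul_of_nonneg_left (hψS x) hw2p.le
  rw [← hs1] at h1
  rw [← hs2] at h2
  have hRx := hR x hx.1
  have ht : 1 < w2 / w1 := by rwa [one_lt_div hw1p]
  have hk := key_ineq θ (w2 / w1) s2 hθ ht (norm_nonneg _)
  have hts : w2 / w1 * s2 = s1 := by field_simp; linarith
  rw [hts] at hk
  have hk' := mul_le_mul_of_nonneg_left hk hw1p.le
  have l1 : w1 * (-(w2 / w1 - 1) / 2) = -(w2 - w1) / 2 := by field_simp
  have l2 : w1 * (s1 ^ θ / θ - s1 ^ 2 / 2 - w2 / w1 * (s2 ^ θ / θ - s2 ^ 2 / 2)) =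
      w1 * (1 / θ * s1 ^ θ) - w1 * s1 ^ 2 / 2 - w2 * (1 / θ * s2 ^ θ) + w2 * s2 ^ 2 / 2 := by
    field_simp; ring
  rw [l1, l2] at hk'
  nlinarith [mul_pos (sub_pos.2 hww) (sub_pos.2 hRx)]
end

section
/- Let m ≥ 1, θ ≥ 2, and let f : ℝ^m → ℝ be locally Lipschitz continuous and coercive. If (λ₁, φ) and (λ₂, ψ) are two solutions of the ergodic problem (EP) such that both φ and ψ are bounded from below on ℝ^m, then λ₁ = λ₂ and there exists a constant C ∈ ℝ such that φ = ψ + C. -/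
open Filter

open Topology

abbrev EE (m : ℕ) := EuclideanSpace ℝ (Fin m)

lemma lap_eq {m : ℕ} (g : EE m → ℝ) (x : EE m) :
    lap g x = ∑ i : Fin m, fderiv ℝ (fderiv ℝ g) x (EuclideanSpace.single i 1)
      (EuclideanSpace.single i 1) := by
  simp [lap, iteratedFDeriv_two_apply]

lemma norm_grad {m : ℕ} (g : EE m → ℝ) (x : EE m) : ‖gradient g x‖ = ‖fderiv ℝ g x‖ := by
  simp [gradient]

lemma norm_fderiv_sq {m : ℕ} (L : EE m →L[ℝ] ℝ) :
    ‖L‖ ^ 2 = ∑ i : Fin m, (L (EuclideanSpace.single i 1)) ^ 2 := by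
  have h1 : ‖L‖ = ‖(InnerProductSpace.toDual ℝ (EE m)).symm L‖ := by simp
  rw [h1, EuclideanSpace.norm_sq_eq]
  refine Finset.sum_congr rfl fun i _ => ?_
  have : L (EuclideanSpace.single i 1) =
      inner ℝ ((InnerProductSpace.toDual ℝ (EE m)).symm L) (EuclideanSpace.single i 1) := by
    simp
  rw [this, EuclideanSpace.inner_single_right]
  simp

lemma diff_fderiv {m : ℕ} {g : EE m → ℝ} (hg : ContDiff ℝ 2 g) : Differentiable ℝ (fderiv ℝ g) :=
  (hg.fderiv_right (m := 1) (by norm_num)).differentiable (by norm_num)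

lemma diff_of {m : ℕ} {g : EE m → ℝ} (hg : ContDiff ℝ 2 g) : Differentiable ℝ g :=
  hg.differentiable (by norm_num)

lemma fderiv2_nonneg {m : ℕ} {g : EE m → ℝ} (hg : ContDiff ℝ 2 g) {x : EE m}
    (h : IsLocalMin g x) (e : EE m) : 0 ≤ fderiv ℝ (fderiv ℝ g) x e e := by
  by_contra hneg
  push Not at hneg
  set k : ℝ → ℝ := fun t => g (x + t • e) with hk
  have hline : ∀ t : ℝ, HasDerivAt (fun t : ℝ => x + t • e) e t := fun t => by
    simpa using ((hasDerivAt_id t).smul_const e).const_add x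
  have hd : ∀ t, HasDerivAt k (fderiv ℝ g (x + t • e) e) t := fun t =>
    ((diff_of hg) (x + t • e)).hasFDerivAt.comp_hasDerivAt t (hline t)
  have hdk : deriv k = fun t => fderiv ℝ g (x + t • e) e := funext fun t => (hd t).deriv
  have hd2 : HasDerivAt (deriv k) (fderiv ℝ (fderiv ℝ g) x e e) 0 := by
    rw [hdk]
    have h0 : HasFDerivAt (fderiv ℝ g) (fderiv ℝ (fderiv ℝ g) x) (x + (0:ℝ) • e) := by
      simpa using (diff_fderiv hg x).hasFDerivAt
    have h1 : HasDerivAt (fun t : ℝ => fderiv ℝ g (x + t • e)) (fderiv ℝ (fderiv ℝ g) x e) 0 :=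
      h0.comp_hasDerivAt (0:ℝ) (hline 0)
    exact ((ContinuousLinearMap.apply ℝ ℝ e).hasFDerivAt).comp_hasDerivAt (0:ℝ) h1
  have hx0 : x + (0:ℝ) • e = x := by simp
  have hmin : IsLocalMin k 0 := by
    have hc : Tendsto (fun t : ℝ => x + t • e) (𝓝 0) (𝓝 x) := by
      have := (hline 0).continuousAt.tendsto
      rwa [hx0] at this
    have := hc.eventually h
    filter_upwards [this] with t ht
    simpa [hk] using ht
  have hmax : IsLocalMax k 0 := by
    apply isLocalMax_of_deriv_deriv_neg
    · rw [hd2.deriv]; exact hneg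
    · exact hmin.deriv_eq_zero
    · exact (hd 0).continuousAt
  have hconst : k =ᶠ[𝓝 0] fun _ => k 0 := by
    filter_upwards [hmin, hmax] with t h1 h2 using le_antisymm h2 h1
  have h3 : deriv k =ᶠ[𝓝 0] fun _ => 0 := by
    have := hconst.deriv
    simpa using this
  have h4 := h3.deriv_eq
  rw [hd2.deriv] at h4
  simp at h4
  linarith

lemma lap_nonneg_of_min {m : ℕ} {g : EE m → ℝ} (hg : ContDiff ℝ 2 g) {x : EE m}
    (h : IsLocalMin g x) : 0 ≤ lap g x := by
  rw [lap_eq]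
  exact Finset.sum_nonneg fun i _ => fderiv2_nonneg hg h _

lemma lap_add {m : ℕ} {g h : EE m → ℝ} (hg : ContDiff ℝ 2 g) (hh : ContDiff ℝ 2 h) (x : EE m) :
    lap (fun x => g x + h x) x = lap g x + lap h x := by
  have : fderiv ℝ (fun x => g x + h x) = fun x => fderiv ℝ g x + fderiv ℝ h x :=
    funext fun y => fderiv_fun_add (diff_of hg y) (diff_of hh y)
  simp only [lap_eq, this, ← Finset.sum_add_distrib]
  rw [fderiv_fun_add (diff_fderiv hg x) (diff_fderiv hh x)]
  simp

lemma lap_const_mul {m : ℕ} {g : EE m → ℝ} (hg : ContDiff ℝ 2 g) (c : ℝ) (x : EE m) :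
    lap (fun x => c * g x) x = c * lap g x := by
  have : fderiv ℝ (fun x => c * g x) = fun x => c • fderiv ℝ g x :=
    funext fun y => fderiv_const_mul (diff_of hg y) c
  simp only [lap_eq, this, Finset.mul_sum]
  rw [fderiv_fun_const_smul (diff_fderiv hg x)]
  simp

lemma lap_add_const {m : ℕ} (g : EE m → ℝ) (c : ℝ) (x : EE m) :
    lap (fun x => g x + c) x = lap g x := by
  have : fderiv ℝ (fun x => g x + c) = fderiv ℝ g :=
    funext fun y => fderiv_add_const c
  simp only [lap_eq, this]

lemma fderiv_exp' {m : ℕ} {g : EE m → ℝ} (hg : ContDiff ℝ 2 g) (x : EE m) :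
    fderiv ℝ (fun x => Real.exp (g x)) x = Real.exp (g x) • fderiv ℝ g x :=
  fderiv_exp (diff_of hg x)

lemma lap_exp {m : ℕ} {g : EE m → ℝ} (hg : ContDiff ℝ 2 g) (x : EE m) :
    lap (fun x => Real.exp (g x)) x = Real.exp (g x) * (‖fderiv ℝ g x‖ ^ 2 + lap g x) := by
  have : fderiv ℝ (fun x => Real.exp (g x)) = fun x => Real.exp (g x) • fderiv ℝ g x :=
    funext fun y => fderiv_exp' hg y
  simp only [lap_eq, this, norm_fderiv_sq, ← Finset.sum_add_distrib, Finset.mul_sum]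
  rw [fderiv_fun_smul ((diff_of hg x).exp) (diff_fderiv hg x), fderiv_exp' hg]
  refine Finset.sum_congr rfl fun i _ => ?_
  simp
  ring

lemma contDiff_q {m : ℕ} (y : EE m) : ContDiff ℝ 2 (fun x : EE m => ‖x - y‖ ^ 2) :=
  (contDiff_id.sub contDiff_const).norm_sq ℝ

lemma fderiv_q {m : ℕ} (y : EE m) (x : EE m) :
    fderiv ℝ (fun x : EE m => ‖x - y‖ ^ 2) x = (2:ℝ) • innerSL ℝ (x - y) := by
  have h : HasFDerivAt (fun x : EE m => ‖x - y‖ ^ 2) _ x :=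
    ((hasFDerivAt_id x).sub_const y).norm_sq
  ext v
  rw [h.fderiv]
  simp

lemma norm_fderiv_q {m : ℕ} (y : EE m) (x : EE m) :
    ‖fderiv ℝ (fun x : EE m => ‖x - y‖ ^ 2) x‖ = 2 * ‖x - y‖ := by
  rw [fderiv_q, norm_smul, innerSL_apply_norm]; simp

lemma lap_q {m : ℕ} (y : EE m) (x : EE m) :
    lap (fun x : EE m => ‖x - y‖ ^ 2) x = 2 * m := by
  have : fderiv ℝ (fun x : EE m => ‖x - y‖ ^ 2) = fun x => (2:ℝ) • innerSL ℝ (x - y) :=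
    funext fun x => fderiv_q y x
  have h2 : HasFDerivAt (fun x : EE m => (2:ℝ) • innerSL ℝ (x - y)) ((2:ℝ) • (innerSL ℝ : EE m →L[ℝ] EE m →L[ℝ] ℝ)) x := by
    have h3 : HasFDerivAt (fun x : EE m => innerSL ℝ (x - y)) (innerSL ℝ : EE m →L[ℝ] EE m →L[ℝ] ℝ) x := 
      ((innerSL ℝ : EE m →L[ℝ] EE m →L[ℝ] ℝ).hasFDerivAt).comp x ((hasFDerivAt_id x).sub_const y)
    exact h3.fun_const_smul 2
  rw [lap_eq, this, h2.fderiv]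
  have : ∀ i : Fin m, ((2:ℝ) • (innerSL ℝ : EE m →L[ℝ] EE m →L[ℝ] ℝ))
      (EuclideanSpace.single i 1) (EuclideanSpace.single i 1) = 2 := fun i => by
    rw [smul_apply, smul_apply, innerSL_apply_apply]
    simp
  simp only [this]
  simp
  ring

/-- Touching: if `g + h` has a local min, gradients are opposite and laplacians compare. -/
lemma touch {m : ℕ} {g h : EE m → ℝ} (hg : ContDiff ℝ 2 g) (hh : ContDiff ℝ 2 h) {x : EE m}
    (hx : IsLocalMin (fun x => g x + h x) x) :
    fderiv ℝ g x = - fderiv ℝ h x ∧ 0 ≤ lap g x + lap h x := by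
  refine ⟨?_, ?_⟩
  · have := hx.fderiv_eq_zero
    rw [fderiv_fun_add (diff_of hg x) (diff_of hh x)] at this
    exact eq_neg_of_add_eq_zero_left this
  · rw [← lap_add hg hh]
    exact lap_nonneg_of_min (hg.add hh) hx

lemma H_anti {θ F : ℝ} (hθ : 2 ≤ θ) (hF : 1/2 < F) :
    StrictAntiOn (fun q : ℝ => 1/2 * q - 1/θ * q ^ (θ - 1) + F * q⁻¹) (Set.Ioi 0) := by
  have hd : ∀ q : ℝ, 0 < q → HasDerivAt (fun q : ℝ => 1/2 * q - 1/θ * q ^ (θ - 1) + F * q⁻¹)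
      (1/2 * 1 - 1/θ * ((θ - 1) * q ^ (θ - 1 - 1)) + F * (-(q ^ 2)⁻¹)) q := fun q hq =>
    (((hasDerivAt_id q).const_mul _).sub
      ((Real.hasDerivAt_rpow_const (Or.inl hq.ne')).const_mul _)).add
      ((hasDerivAt_inv hq.ne').const_mul F)
  apply strictAntiOn_of_deriv_neg (convex_Ioi 0)
  · exact fun q hq => (hd q hq).continuousAt.continuousWithinAt
  · intro q hq
    rw [interior_Ioi] at hq
    have hq0 : 0 < q := hq
    rw [(hd q hq).deriv]
    have h1 : 1/θ * ((θ - 1) * q ^ (θ - 1 - 1)) = (1 - 1/θ) * q ^ (θ - 1 - 1) := by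
      field_simp
    have h2 : 1/θ ≤ 1/2 := one_div_le_one_div_of_le (by norm_num) hθ
    have hp : 0 < q ^ (θ - 1 - 1) := Real.rpow_pos_of_pos hq0 _
    have hi : 0 < (q^2)⁻¹ := by positivity
    rw [h1]
    rcases le_total 1 q with hq1 | hq1
    · have h3 : 1 ≤ q ^ (θ - 1 - 1) := Real.one_le_rpow hq1 (by linarith)
      nlinarith
    · have h3 : 1 ≤ (q^2)⁻¹ := by
        rw [one_le_inv₀ (by positivity)]; nlinarith
      nlinarith

lemma key_ineq_s9 {θ F₁ F₂ a b P Q : ℝ} (hθ : 2 ≤ θ) (hF : 1/2 < F₂) (hFF : F₂ ≤ F₁) (hb : 0 < b)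
    (hab : b < a) (hP : 0 ≤ P) (hQ : 0 ≤ Q) (hpq : a * P = b * Q) :
    b * (1/2 * Q ^ 2 - 1/θ * Q ^ θ + F₂) < a * (1/2 * P ^ 2 - 1/θ * P ^ θ + F₁) := by
  rcases hP.eq_or_lt with h | hP0
  · subst h
    have : Q = 0 := by
      rcases mul_eq_zero.1 (by linarith : b * Q = 0) with h | h
      · linarith
      · exact h
    subst this
    rw [Real.zero_rpow (by linarith)]
    nlinarith
  · have hQ0 : 0 < Q := by
      by_contra hn
      have : Q = 0 := by linarith
      subst this
      nlinarith [mul_pos (hb.trans hab) hP0]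
    have hlt : P < Q := by
      by_contra hn
      push Not at hn
      nlinarith
    have h := H_anti (F := F₂) hθ hF hP0 hQ0 hlt
    simp only at h
    have e : ∀ q : ℝ, 0 < q → 1/2 * q ^ 2 - 1/θ * q ^ θ + F₂ =
        q * (1/2 * q - 1/θ * q ^ (θ - 1) + F₂ * q⁻¹) := fun q hq => by
      have : q ^ θ = q * q ^ (θ - 1) := by
        rw [Real.rpow_sub_one hq.ne']; field_simp
      rw [this]; field_simp
    have h5 : b * (1/2 * Q ^ 2 - 1/θ * Q ^ θ + F₂) < a * (1/2 * P ^ 2 - 1/θ * P ^ θ + F₂) := by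
      rw [e P hP0, e Q hQ0, ← mul_assoc, ← mul_assoc, hpq]
      exact mul_lt_mul_of_pos_left h (mul_pos hb hQ0)
    nlinarith

lemma eventually_norm {m : ℕ} {p : EE m → Prop} (h : ∀ᶠ x in cocompact (EE m), p x) :
    ∃ R : ℝ, ∀ x, R < ‖x‖ → p x := by
  obtain ⟨K, hK, hs⟩ := mem_cocompact.1 h
  obtain ⟨R, hR⟩ := hK.isBounded.exists_norm_le
  refine ⟨R, fun x hx => hs fun hxK => ?_⟩
  linarith [hR x hxK]

lemma sol_coercive {m : ℕ} {θ : ℝ} (hθ : 2 ≤ θ) {f φ : EE m → ℝ} {lam : ℝ} (hcoer : Coercive f)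
    (h : IsSolution θ f lam φ) (hφ : BddBelow (Set.range φ)) :
    Tendsto φ (cocompact (EE m)) atTop := by
  obtain ⟨hc2, heq⟩ := h
  obtain ⟨B, hB⟩ := hφ
  have hB : ∀ x, B ≤ φ x := fun x => hB ⟨x, rfl⟩
  rw [tendsto_atTop]
  intro N
  set c : ℝ := |N - B| + 1 with hc
  have hc0 : 0 < c := by positivity
  obtain ⟨R, hR⟩ := eventually_norm (hcoer.eventually_gt_atTop (c * m + 1/θ * (2*c) ^ θ + lam))
  have hfar : ∀ᶠ y in cocompact (EE m), R + 1 < ‖y‖ :=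
    (tendsto_norm_cocompact_atTop (E := EE m)).eventually_gt_atTop (R+1)
  filter_upwards [hfar] with y hy
  have hq : ContDiff ℝ 2 (fun x : EE m => c * ‖x - y‖ ^ 2) := contDiff_const.mul (contDiff_q y)
  have hcont : Continuous (fun x => φ x + c * ‖x - y‖ ^ 2) := hc2.continuous.add hq.continuous
  obtain ⟨x, hx, hmin⟩ := (isCompact_closedBall y (1:ℝ)).exists_isMinOn
    ⟨y, Metric.mem_closedBall_self zero_le_one⟩ hcont.continuousOn
  have hxy : ‖x - y‖ ≤ 1 := by simpa [dist_eq_norm] using hx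
  rcases hxy.lt_or_eq with hlt | heq1
  · exfalso
    have hloc : IsLocalMin (fun x => φ x + c * ‖x - y‖ ^ 2) x :=
      hmin.isLocalMin (Metric.closedBall_mem_nhds_of_mem (by simpa [dist_eq_norm] using hlt))
    obtain ⟨h1, h2⟩ := touch hc2 hq hloc
    rw [lap_const_mul (contDiff_q y), lap_q] at h2
    have h3 : ‖gradient φ x‖ ≤ 2 * c := by
      rw [norm_grad, h1, norm_neg, fderiv_const_mul (diff_of (contDiff_q y) x), norm_smul,
        norm_fderiv_q, Real.norm_eq_abs, abs_of_pos hc0]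
      nlinarith
    have h4 : ‖gradient φ x‖ ^ θ ≤ (2*c) ^ θ :=
      Real.rpow_le_rpow (norm_nonneg _) h3 (by linarith)
    have h5 : 1/θ * ‖gradient φ x‖ ^ θ ≤ 1/θ * (2*c) ^ θ :=
      mul_le_mul_of_nonneg_left h4 (by positivity)
    have h6 : R < ‖x‖ := by
      have := norm_sub_norm_le y x
      rw [norm_sub_rev] at this
      linarith
    have h7 := hR x h6
    have h8 := heq x
    nlinarith
  · have h1 := hmin (Metric.mem_closedBall_self zero_le_one : y ∈ Metric.closedBall y 1)
    simp only [Set.mem_ofPred_eq, heq1, sub_self, norm_zero] at h1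
    have := hB x
    have := le_abs_self (N - B)
    nlinarith

set_option maxHeartbeats 1600000 in
lemma smp {m : ℕ} {w : EE m → ℝ} (hw : ContDiff ℝ 2 w) (h0 : ∀ x, 0 ≤ w x) {x₀ : EE m}
    (hx₀ : w x₀ = 0)
    (hC : ∀ (z : EE m) (ρ : ℝ), ∃ C, 0 ≤ C ∧ ∀ x ∈ Metric.closedBall z ρ,
      lap w x ≤ C * ‖fderiv ℝ w x‖) (y : EE m) : w y = 0 := by
  by_contra hy
  set Z : Set (EE m) := {x | w x = 0} with hZ
  have hZc : IsClosed Z := isClosed_eq hw.continuous continuous_const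
  obtain ⟨z, hzZ, hz⟩ := hZc.exists_infDist_eq_dist ⟨x₀, hx₀⟩ y
  have hwz : w z = 0 := hzZ
  have hdist : ∀ x, w x = 0 → ‖z - y‖ ≤ ‖x - y‖ := fun x hx => by
    have := Metric.infDist_le_dist_of_mem (x := y) (show x ∈ Z from hx)
    rw [hz, dist_comm, dist_comm y x, dist_eq_norm, dist_eq_norm] at this
    exact this
  have hne : z ≠ y := fun h => hy (h ▸ hwz)
  set y' : EE m := (1/2 : ℝ) • (y + z) with hy'
  set r : ℝ := ‖z - y'‖ with hr
  have hzy' : z - y' = (1/2 : ℝ) • (z - y) := by rw [hy']; module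
  have hyy' : y' - y = z - y' := by rw [hy']; module
  have hr2 : ‖z - y‖ = 2 * r := by
    rw [hr, hzy', norm_smul]; norm_num; ring
  have hr0 : 0 < r := by
    have : 0 < ‖z - y‖ := norm_pos_iff.2 (sub_ne_zero.2 hne)
    linarith
  have huniq : ∀ x, ‖x - y'‖ ≤ r → w x = 0 → x = z := fun x hx hwx => by
    have h1 := hdist x hwx
    have h2 := parallelogram_law_with_norm ℝ (x - y') (y' - y)
    have e1 : x - y' + (y' - y) = x - y := by abel
    have e2 : x - y' - (y' - y) = x - z := by rw [hyy']; abel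
    rw [e1, e2, hyy', ← hr] at h2
    have h3 : ‖x - z‖ = 0 := by
      have := norm_nonneg (x - y')
      have := norm_nonneg (x - z)
      nlinarith
    exact sub_eq_zero.1 (norm_eq_zero.1 h3)
  set ρ : ℝ := r / 2 with hρ
  obtain ⟨C, hC0, hC⟩ := hC z ρ
  set α : ℝ := 2 * (m + 2 * C * r + 1) / r ^ 2 with hα
  have hα0 : 0 < α := by positivity
  have hαr : α * r ^ 2 = 2 * (m + 2 * C * r + 1) := by rw [hα]; field_simp
  -- lower bound on the sphere
  obtain ⟨δ, hδ0, hδ⟩ : ∃ δ > 0, ∀ x ∈ Metric.sphere z ρ ∩ Metric.closedBall y' r, δ ≤ w x := by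
    have hcomp : IsCompact (Metric.sphere z ρ ∩ Metric.closedBall y' r) :=
      (isCompact_sphere z ρ).inter_right Metric.isClosed_closedBall
    rcases (Metric.sphere z ρ ∩ Metric.closedBall y' r).eq_empty_or_nonempty with he | hne'
    · exact ⟨1, one_pos, by simp [he]⟩
    · obtain ⟨x, hx, hmin⟩ := hcomp.exists_isMinOn hne' hw.continuous.continuousOn
      refine ⟨w x, (h0 x).lt_of_ne fun h => ?_, fun x' hx' => hmin hx'⟩
      have h1 := huniq x (by simpa [dist_eq_norm] using hx.2) h.symm
      have h2 := hx.1
      rw [h1, Metric.mem_sphere, dist_self] at h2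
      linarith
  set ε : ℝ := δ / 2 with hε
  have hε0 : 0 < ε := by positivity
  have hqc : ContDiff ℝ 2 (fun x : EE m => (-α) * ‖x - y'‖ ^ 2) :=
    contDiff_const.mul (contDiff_q y')
  have hec : ContDiff ℝ 2 (fun x : EE m => Real.exp ((-α) * ‖x - y'‖ ^ 2)) := hqc.exp
  have hkc : ContDiff ℝ 2 (fun x : EE m => (-ε) * Real.exp ((-α) * ‖x - y'‖ ^ 2)) :=
    contDiff_const.mul hec
  set A : ℝ := Real.exp ((-α) * r ^ 2) with hA
  have hA0 : 0 < A := Real.exp_pos _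
  have hcont : Continuous (fun x => w x + (-ε) * Real.exp ((-α) * ‖x - y'‖ ^ 2)) :=
    hw.continuous.add hkc.continuous
  obtain ⟨x, hx, hmin⟩ := (isCompact_closedBall z ρ).exists_isMinOn
    ⟨z, Metric.mem_closedBall_self (by positivity)⟩ hcont.continuousOn
  have hz1 := hmin (Metric.mem_closedBall_self (by positivity) : z ∈ Metric.closedBall z ρ)
  simp only [Set.mem_ofPred_eq, hwz, ← hr, ← hA] at hz1
  have hxz : ‖x - z‖ ≤ ρ := by simpa [dist_eq_norm] using hx
  have hint : ‖x - z‖ < ρ := by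
    refine hxz.lt_of_ne fun he => ?_
    rcases le_or_gt ‖x - y'‖ r with h1 | h1
    · have h2 := hδ x ⟨by simpa [dist_eq_norm] using he, by simpa [dist_eq_norm] using h1⟩
      have h3 : Real.exp ((-α) * ‖x - y'‖ ^ 2) ≤ 1 := by
        rw [Real.exp_le_one_iff]
        have := sq_nonneg ‖x - y'‖
        nlinarith
      nlinarith
    · have h3 : Real.exp ((-α) * ‖x - y'‖ ^ 2) < A := by
        rw [hA, Real.exp_lt_exp]
        have : r ^ 2 < ‖x - y'‖ ^ 2 := by gcongr
        nlinarith
      have := h0 x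
      nlinarith
  have hloc := hmin.isLocalMin
    (Metric.closedBall_mem_nhds_of_mem (by simpa [dist_eq_norm] using hint))
  obtain ⟨h1, h2⟩ := touch hw hkc hloc
  set s : ℝ := ‖x - y'‖ with hs
  have hs1 : r / 2 ≤ s := by
    have : r ≤ ‖x - z‖ + s := by
      rw [hr, hs, norm_sub_rev x z]
      calc ‖z - y'‖ = ‖(z - x) + (x - y')‖ := by congr 1; abel
        _ ≤ _ := norm_add_le _ _
    linarith
  have hs2 : s ≤ 2 * r := by
    have : s ≤ ‖x - z‖ + r := by
      rw [hr, hs]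
      calc ‖x - y'‖ = ‖(x - z) + (z - y')‖ := by congr 1; abel
        _ ≤ _ := norm_add_le _ _
    linarith
  have hnq : ‖fderiv ℝ (fun x : EE m => (-α) * ‖x - y'‖ ^ 2) x‖ = α * (2 * s) := by
    rw [fderiv_const_mul (diff_of (contDiff_q y') x), norm_smul, norm_fderiv_q, norm_neg,
      Real.norm_eq_abs, abs_of_pos hα0]
  rw [lap_const_mul hec, lap_exp hqc, hnq, lap_const_mul (contDiff_q y'), lap_q] at h2
  have h3 : ‖fderiv ℝ w x‖ = ε * (Real.exp (-α * s ^ 2) * (α * (2 * s))) := by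
    rw [h1, norm_neg, fderiv_const_mul (diff_of hec x), norm_smul, fderiv_exp' hqc, norm_smul,
      hnq, norm_neg, Real.norm_eq_abs, Real.norm_eq_abs, abs_of_pos hε0, Real.abs_exp]
  have h4 := hC x hx
  rw [h3] at h4
  set E : ℝ := Real.exp (-α * s ^ 2) with hE
  have hE0 : 0 < E := Real.exp_pos _
  have h5 : 0 ≤ (2 * α * ε * E) * (C * s + m - 2 * α * s ^ 2) := by
    linear_combination h2 + h4
  have h6 : 0 ≤ C * s + m - 2 * α * s ^ 2 := nonneg_of_mul_nonneg_right h5 (by positivity)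
  have h7 : (r/2)^2 ≤ s ^ 2 := by gcongr
  have h8 : C * s ≤ C * (2 * r) := mul_le_mul_of_nonneg_left hs2 hC0
  have h9 : α * (r/2)^2 ≤ α * s^2 := mul_le_mul_of_nonneg_left h7 hα0.le
  nlinarith

lemma rpow_lip {θ R a b : ℝ} (hθ : 2 ≤ θ) (ha : 0 ≤ a) (hb : 0 ≤ b) (haR : a ≤ R) (hbR : b ≤ R) :
    |a ^ θ - b ^ θ| ≤ θ * R ^ (θ - 1) * |a - b| := by
  have := Convex.norm_image_sub_le_of_norm_hasDerivWithin_le (f := fun x : ℝ => x ^ θ)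
    (f' := fun x => θ * x ^ (θ - 1)) (s := Set.Icc 0 R) (x := b) (y := a) (C := θ * R ^ (θ - 1))
    (fun x _ => (Real.hasDerivAt_rpow_const (Or.inr (by linarith))).hasDerivWithinAt)
    (fun x hx => by
      have h1 : x ^ (θ - 1) ≤ R ^ (θ - 1) := Real.rpow_le_rpow hx.1 hx.2 (by linarith)
      have h2 : 0 ≤ x ^ (θ - 1) := Real.rpow_nonneg hx.1 _
      rw [Real.norm_eq_abs, abs_of_nonneg (by positivity)]
      exact mul_le_mul_of_nonneg_left h1 (by linarith))
    (convex_Icc 0 R) ⟨hb, hbR⟩ ⟨ha, haR⟩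
  simpa using this

lemma main_aux {m : ℕ} {θ : ℝ} (hθ : 2 ≤ θ) {f : EE m → ℝ} (hcoer : Coercive f)
    {lam₁ lam₂ : ℝ} {φ ψ : EE m → ℝ}
    (h₁ : IsSolution θ f lam₁ φ) (h₂ : IsSolution θ f lam₂ ψ)
    (hφ : BddBelow (Set.range φ)) (hle : lam₁ ≤ lam₂) :
    lam₁ = lam₂ ∧ ∃ C : ℝ, ∀ y, φ y = ψ y + C := by
  have hφt := sol_coercive hθ hcoer h₁ hφ
  obtain ⟨hφc, hφe⟩ := h₁
  obtain ⟨hψ₀c, hψ₀e⟩ := h₂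
  obtain ⟨R₀, hR₀⟩ := eventually_norm (hcoer.eventually_gt_atTop (1/2 + lam₂))
  set R := max R₀ 0 with hRdef
  have hR : ∀ x, R < ‖x‖ → 1/2 + lam₂ < f x := fun x hx =>
    hR₀ x ((le_max_left _ _).trans_lt hx)
  obtain ⟨x₀, -, hx₀⟩ := (isCompact_closedBall (0 : EE m) R).exists_isMinOn
    ⟨0, Metric.mem_closedBall_self (le_max_right _ _)⟩
    (hφc.continuous.sub hψ₀c.continuous).continuousOn
  set D : ℝ := φ x₀ - ψ x₀ with hD
  obtain ⟨χ, hχ⟩ : ∃ χ : EE m → ℝ, χ = fun x => ψ x + D := ⟨_, rfl⟩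
  have hχc : ContDiff ℝ 2 χ := by rw [hχ]; exact hψ₀c.add contDiff_const
  have hχf : ∀ x, fderiv ℝ χ x = fderiv ℝ ψ x := fun x => by rw [hχ]; exact fderiv_add_const D
  have hχl : ∀ x, lap χ x = lap ψ x := fun x => by rw [hχ]; exact lap_add_const ψ D x
  have hχe : ∀ x, -(1/2) * lap χ x + (1/θ) * ‖fderiv ℝ χ x‖ ^ θ = f x - lam₂ := fun x => by
    rw [hχl, hχf, ← norm_grad]; exact hψ₀e x
  have hφe : ∀ x, -(1/2) * lap φ x + (1/θ) * ‖fderiv ℝ φ x‖ ^ θ = f x - lam₁ := fun x => by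
    rw [← norm_grad]; exact hφe x
  have hin : ∀ x, ‖x‖ ≤ R → χ x ≤ φ x := fun x hx => by
    have := hx₀ (show x ∈ Metric.closedBall (0 : EE m) R by simpa using hx)
    simp only [Set.mem_ofPred_eq, Pi.sub_apply] at this
    rw [hχ]; simp only; linarith
  have hx₀e : φ x₀ = χ x₀ := by rw [hχ, hD]; simp
  -- global comparison
  have hall : ∀ x, χ x ≤ φ x := by
    by_contra hcon
    push Not at hcon
    obtain ⟨x₁, hx₁⟩ := hcon
    have hnφ : ContDiff ℝ 2 (fun x => (-1) * φ x) := contDiff_const.mul hφc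
    have hnχ : ContDiff ℝ 2 (fun x => (-1) * χ x) := contDiff_const.mul hχc
    have huc : ContDiff ℝ 2 (fun x => Real.exp ((-1) * φ x)) := hnφ.exp
    have hvc : ContDiff ℝ 2 (fun x => Real.exp ((-1) * χ x)) := hnχ.exp
    have hnuc : ContDiff ℝ 2 (fun x => (-1) * Real.exp ((-1) * φ x)) := contDiff_const.mul huc
    have hg0 : Real.exp ((-1) * χ x₁) + (-1) * Real.exp ((-1) * φ x₁) < 0 := by
      have := Real.exp_lt_exp.2 (show (-1) * χ x₁ < (-1) * φ x₁ by linarith)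
      linarith
    have hut : Tendsto (fun x => Real.exp ((-1) * φ x)) (cocompact (EE m)) (𝓝 0) := by
      apply Real.tendsto_exp_atBot.comp
      exact (tendsto_neg_atTop_atBot.comp hφt).congr fun x => by simp
    have hev : ∀ᶠ x in cocompact (EE m),
        Real.exp ((-1) * χ x₁) + (-1) * Real.exp ((-1) * φ x₁) ≤
        Real.exp ((-1) * χ x) + (-1) * Real.exp ((-1) * φ x) := by
      filter_upwards [hut.eventually_lt_const (show (0:ℝ) <
        -(Real.exp ((-1) * χ x₁) + (-1) * Real.exp ((-1) * φ x₁)) by linarith)] with x hx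
      have := Real.exp_pos ((-1) * χ x)
      linarith
    obtain ⟨x, hx⟩ := (hvc.add hnuc).continuous.exists_forall_le' x₁ hev
    have hloc : IsLocalMin (fun x => Real.exp ((-1) * χ x) + (-1) * Real.exp ((-1) * φ x)) x :=
      Eventually.of_forall hx
    have hneg := (hx x₁).trans_lt hg0
    obtain ⟨h1, h2⟩ := touch hvc hnuc hloc
    have hab : Real.exp ((-1) * χ x) < Real.exp ((-1) * φ x) := by
      linarith
    have hout : R < ‖x‖ := by
      by_contra hn
      have h3 := hin x (not_lt.1 hn)
      have h4 := Real.exp_lt_exp.1 hab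
      linarith
    have hfx := hR x hout
    rw [fderiv_const_mul (diff_of huc x), fderiv_exp' hnφ, fderiv_exp' hnχ,
      fderiv_const_mul (diff_of hφc x), fderiv_const_mul (diff_of hχc x)] at h1
    rw [lap_const_mul huc, lap_exp hnφ, lap_exp hnχ, lap_const_mul hφc, lap_const_mul hχc,
      fderiv_const_mul (diff_of hφc x), fderiv_const_mul (diff_of hχc x), norm_smul, norm_smul] at h2
    have h1n := congrArg norm h1
    simp only [norm_neg, norm_smul, norm_one, one_mul, Real.norm_eq_abs, Real.abs_exp] at h1n
    simp only [norm_neg, norm_one, one_mul] at h2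
    have hk := key_ineq_s9 (F₁ := f x - lam₁) (F₂ := f x - lam₂) hθ (by linarith) (by linarith)
      (Real.exp_pos ((-1) * χ x)) hab (norm_nonneg (fderiv ℝ φ x)) (norm_nonneg (fderiv ℝ χ x))
      (by simpa using h1n.symm)
    rw [← hφe x, ← hχe x] at hk
    nlinarith
  have hloc : IsLocalMin (fun x => φ x + (-1) * χ x) x₀ := by
    refine Eventually.of_forall fun x => ?_
    have := hall x
    simp only
    linarith
  have hnχ : ContDiff ℝ 2 (fun x => (-1) * χ x) := contDiff_const.mul hχc
  obtain ⟨h1, h2⟩ := touch hφc hnχ hloc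
  rw [lap_const_mul hχc] at h2
  rw [fderiv_const_mul (diff_of hχc x₀)] at h1
  have h3 : fderiv ℝ φ x₀ = fderiv ℝ χ x₀ := by rw [h1]; simp
  have hlam : lam₁ = lam₂ := by
    have e1 := hφe x₀
    have e2 := hχe x₀
    rw [h3] at e1
    linarith
  refine ⟨hlam, D, fun y => ?_⟩
  have hwc : ContDiff ℝ 2 (fun x => φ x + (-1) * χ x) := hφc.add hnχ
  have := smp hwc (fun x => by have := hall x; linarith) (x₀ := x₀) (by rw [hx₀e]; ring) (by
    intro z ρ
    obtain ⟨R₁, hR₁⟩ := (isCompact_closedBall z ρ).exists_bound_of_continuousOn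
      (hφc.continuous_fderiv (by norm_num)).continuousOn
    obtain ⟨R₂, hR₂⟩ := (isCompact_closedBall z ρ).exists_bound_of_continuousOn
      (hχc.continuous_fderiv (by norm_num)).continuousOn
    set S : ℝ := max (max R₁ R₂) 0 with hS
    have hS0 : 0 ≤ S := le_max_right _ _
    refine ⟨2 * S ^ (θ - 1), by positivity, fun x hx => ?_⟩
    have b1 : ‖fderiv ℝ φ x‖ ≤ S := (hR₁ x hx).trans ((le_max_left _ _).trans (le_max_left _ _))
    have b2 : ‖fderiv ℝ χ x‖ ≤ S := (hR₂ x hx).trans ((le_max_right _ _).trans (le_max_left _ _))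
    have b3 := rpow_lip hθ (norm_nonneg _) (norm_nonneg _) b1 b2
    have b4 : |‖fderiv ℝ φ x‖ - ‖fderiv ℝ χ x‖| ≤ ‖fderiv ℝ φ x - fderiv ℝ χ x‖ :=
      abs_norm_sub_norm_le _ _
    have b5 : fderiv ℝ (fun x => φ x + (-1) * χ x) x = fderiv ℝ φ x - fderiv ℝ χ x := by
      rw [fderiv_fun_add (diff_of hφc x) (diff_of hnχ x), fderiv_const_mul (diff_of hχc x)]
      module
    rw [b5, lap_add hφc hnχ, lap_const_mul hχc]
    have e1 := hφe x
    have e2 := hχe x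
    have b6 := (le_abs_self _).trans b3
    have b7 : lap φ x + -1 * lap χ x = 2 * (1/θ * (‖fderiv ℝ φ x‖ ^ θ - ‖fderiv ℝ χ x‖ ^ θ)) := by
      linarith
    have b8 : 1/θ * (‖fderiv ℝ φ x‖ ^ θ - ‖fderiv ℝ χ x‖ ^ θ) ≤
        1/θ * (θ * S ^ (θ - 1) * |‖fderiv ℝ φ x‖ - ‖fderiv ℝ χ x‖|) :=
      mul_le_mul_of_nonneg_left b6 (by positivity)
    have b9 : 1/θ * (θ * S ^ (θ - 1) * |‖fderiv ℝ φ x‖ - ‖fderiv ℝ χ x‖|) =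
        S ^ (θ - 1) * |‖fderiv ℝ φ x‖ - ‖fderiv ℝ χ x‖| := by field_simp
    have b10 := mul_le_mul_of_nonneg_left b4 (Real.rpow_nonneg hS0 (θ - 1))
    linarith) y
  have hy : χ y = ψ y + D := by rw [hχ]
  linarith

theorem stmt9 (m : ℕ) (hm : 1 ≤ m) (θ : ℝ) (hθ : 2 ≤ θ)
    (f : EuclideanSpace ℝ (Fin m) → ℝ) (hf : LocallyLipschitz f) (hcoer : Coercive f)
    (lam₁ lam₂ : ℝ) (φ ψ : EuclideanSpace ℝ (Fin m) → ℝ)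
    (h₁ : IsSolution θ f lam₁ φ) (h₂ : IsSolution θ f lam₂ ψ)
    (hφ : BddBelow (Set.range φ)) (hψ : BddBelow (Set.range ψ)) :
    lam₁ = lam₂ ∧ ∃ C : ℝ, ∀ y, φ y = ψ y + C := by 
  rcases le_total lam₁ lam₂ with h | h
  · exact main_aux hθ hcoer h₁ h₂ hφ h
  · obtain ⟨e, C, hC⟩ := main_aux hθ hcoer h₂ h₁ hψ h
    exact ⟨e.symm, -C, fun y => by rw [hC y]; ring⟩
end

section
/- Let m ≥ 1, θ > 1, and let f : ℝ^m → ℝ satisfy (H0) and (H1) with parameters α, f₀ > 0. If (λ, φ) is a solution of the ergodic problem (EP) with φ bounded from below, then, with γ = α/θ + 1, there exists c > 0 such that φ(y) ≥ c|y|^γ − c^{−1} for all y ∈ ℝ^m. -/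
open Filter

lemma oneD_min (h h' : ℝ → ℝ) (c : ℝ) (h1 : ∀ t, HasDerivAt h (h' t) t)
    (h2 : HasDerivAt h' c 0) (hmin : IsLocalMin h 0) : h' 0 = 0 ∧ 0 ≤ c := by
  have h0 : h' 0 = 0 := hmin.hasDerivAt_eq_zero (h1 0)
  refine ⟨h0, ?_⟩
  by_contra hc
  push Not at hc
  have hd : deriv h = h' := funext fun t => (h1 t).deriv
  have hmax : IsLocalMax h 0 := by
    apply isLocalMax_of_deriv_deriv_neg
    · rw [hd, h2.deriv]; exact hc
    · rw [hd]; exact h0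
    · exact (h1 0).continuousAt
  have heq : h =ᶠ[nhds 0] fun _ => h 0 := by
    filter_upwards [hmin, hmax] with t a b
    exact le_antisymm b a
  have hz : h' =ᶠ[nhds 0] fun _ => 0 := by
    filter_upwards [heq.eventuallyEq_nhds] with t ht
    have := ht.deriv_eq
    rw [hd] at this
    simpa using this
  have := hz.deriv_eq
  rw [h2.deriv] at this
  simp at this
  linarith

lemma line_cond {m : ℕ} (φ : EuclideanSpace ℝ (Fin m) → ℝ) (hφ : ContDiff ℝ 2 φ)
    (A : ℝ) (x y e : EuclideanSpace ℝ (Fin m))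
    (hmin : IsLocalMin (fun z => φ z + A * ‖z - y‖ ^ 2) x) :
    fderiv ℝ φ x e + A * (2 * inner ℝ (x - y) e) = 0 ∧
    0 ≤ iteratedFDeriv ℝ 2 φ x ![e, e] + 2 * A * ‖e‖ ^ 2 := by
  have hline : ∀ t : ℝ, HasDerivAt (fun t : ℝ => x + t • e) e t := fun t => by
    simpa using ((hasDerivAt_id t).smul_const e).const_add x
  have hd : Differentiable ℝ φ := hφ.differentiable (by norm_num)
  have hd2 : Differentiable ℝ (fderiv ℝ φ) :=
    (hφ.fderiv_right (m := 1) (by norm_num)).differentiable (by norm_num)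
  have hq : ∀ t : ℝ, ‖x + t • e - y‖ ^ 2 =
      ‖x - y‖ ^ 2 + 2 * t * inner ℝ (x - y) e + t ^ 2 * ‖e‖ ^ 2 := fun t => by
    rw [show x + t • e - y = (x - y) + t • e by abel, norm_add_sq_real, inner_smul_right,
      norm_smul, mul_pow, Real.norm_eq_abs, sq_abs]
    ring
  set I : ℝ := inner ℝ (x - y) e with hI
  have hA1 : ∀ t : ℝ, HasDerivAt (fun t : ℝ => φ (x + t • e) + A * ‖x + t • e - y‖ ^ 2)
      (fderiv ℝ φ (x + t • e) e + A * (2 * I + 2 * t * ‖e‖ ^ 2)) t := by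
    intro t
    have hfun : (fun t : ℝ => φ (x + t • e) + A * ‖x + t • e - y‖ ^ 2) =
        fun t : ℝ => φ (x + t • e) + A * (‖x - y‖ ^ 2 + 2 * t * I + t ^ 2 * ‖e‖ ^ 2) :=
      funext fun t => by rw [hq t]
    rw [hfun]
    have hp : ∀ a b c : ℝ, HasDerivAt (fun t : ℝ => a + 2 * t * b + t ^ 2 * c)
        (2 * b + 2 * t * c) t := by
      intro a b c
      have := ((((hasDerivAt_id' t).const_mul 2).mul_const b).const_add a).fun_add
        (((hasDerivAt_id' t).fun_pow 2).mul_const c)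
      exact this.congr_deriv (by push_cast; ring)
    have h1 : HasDerivAt (fun t : ℝ => φ (x + t • e)) (fderiv ℝ φ (x + t • e) e) t :=
      (hd (x + t • e)).hasFDerivAt.comp_hasDerivAt t (hline t)
    exact h1.fun_add ((hp _ _ _).const_mul A)
  have hA2 : HasDerivAt (fun t : ℝ => fderiv ℝ φ (x + t • e) e + A * (2 * I + 2 * t * ‖e‖ ^ 2))
      (fderiv ℝ (fderiv ℝ φ) x e e + A * (2 * ‖e‖ ^ 2)) 0 := by
    have h0 : x + (0:ℝ) • e = x := by simp
    have hF : HasFDerivAt (fderiv ℝ φ) (fderiv ℝ (fderiv ℝ φ) x) (x + (0:ℝ) • e) := by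
      rw [h0]; exact (hd2 x).hasFDerivAt
    have h1 : HasDerivAt (fun t : ℝ => fderiv ℝ φ (x + t • e))
        (fderiv ℝ (fderiv ℝ φ) x e) 0 := hF.comp_hasDerivAt (0:ℝ) (hline 0)
    have h1' : HasDerivAt (fun t : ℝ => fderiv ℝ φ (x + t • e) e)
        (fderiv ℝ (fderiv ℝ φ) x e e) 0 := by
      simpa using h1.clm_apply (hasDerivAt_const (0:ℝ) e)
    have hp : ∀ b c : ℝ, HasDerivAt (fun t : ℝ => A * (2 * b + 2 * t * c)) (A * (2 * c)) 0 := by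
      intro b c
      have := ((((hasDerivAt_id' (0:ℝ)).const_mul 2).mul_const c).const_add (2 * b)).const_mul A
      exact this.congr_deriv (by push_cast; ring)
    exact h1'.fun_add (hp _ _)
  have hA3 : IsLocalMin (fun t : ℝ => φ (x + t • e) + A * ‖x + t • e - y‖ ^ 2) 0 := by
    have hc : ContinuousAt (fun t : ℝ => x + t • e) 0 := (hline 0).continuousAt
    have h0 : x + (0:ℝ) • e = x := by simp
    have : ∀ᶠ t : ℝ in nhds 0, φ x + A * ‖x - y‖ ^ 2 ≤ φ (x + t • e) + A * ‖x + t • e - y‖ ^ 2 := by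
      apply hc.eventually (p := fun z => φ x + A * ‖x - y‖ ^ 2 ≤ φ z + A * ‖z - y‖ ^ 2)
      show ∀ᶠ z in nhds (x + (0:ℝ) • e), _
      rw [h0]; exact hmin
    filter_upwards [this] with t ht
    rw [h0]; exact ht
  have key := oneD_min _ _ _ hA1 hA2 hA3
  refine ⟨by simpa using key.1, ?_⟩
  rw [iteratedFDeriv_two_apply]
  have := key.2
  simp only [Matrix.cons_val_zero, Matrix.cons_val_one]
  linarith

lemma ball_comp {m : ℕ} (θ : ℝ) (hθ : 1 < θ) (φ g : EuclideanSpace ℝ (Fin m) → ℝ)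
    (hφ : ContDiff ℝ 2 φ)
    (heq : ∀ y, -(1/2) * lap φ y + (1/θ) * ‖gradient φ y‖ ^ θ = g y)
    (M A r : ℝ) (hA : 0 ≤ A) (hr : 0 < r) (hM : ∀ y, -M ≤ φ y)
    (y : EuclideanSpace ℝ (Fin m))
    (hg : ∀ x, ‖x - y‖ ≤ r → m * A + (1/θ) * (2 * A * r) ^ θ < g x) :
    A * r ^ 2 - M ≤ φ y := by
  obtain ⟨x, hx, hxmin⟩ := (isCompact_closedBall y r).exists_isMinOn
    (Metric.nonempty_closedBall.2 hr.le)
    (f := fun z => φ z + A * ‖z - y‖ ^ 2)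
    ((hφ.continuous.add (by fun_prop)).continuousOn)
  have hy : φ x + A * ‖x - y‖ ^ 2 ≤ φ y := by
    simpa using hxmin (Metric.mem_closedBall_self hr.le)
  have hxr : ‖x - y‖ ≤ r := by simpa [dist_eq_norm] using hx
  rcases hxr.lt_or_eq with hlt | heq'
  · exfalso
    have hloc : IsLocalMin (fun z => φ z + A * ‖z - y‖ ^ 2) x :=
      hxmin.isLocalMin (Filter.mem_of_superset (Metric.isOpen_ball.mem_nhds
        (by simpa [dist_eq_norm] using hlt)) Metric.ball_subset_closedBall)
    have hgrad : gradient φ x = (-(2 * A)) • (x - y) := by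
      refine ext_inner_right ℝ fun e => ?_
      have := (line_cond φ hφ A x y e hloc).1
      rw [gradient, InnerProductSpace.toDual_symm_apply, inner_smul_left]
      simp
      linarith
    have hlap : -(2 * A * m) ≤ lap φ x := by
      have : ∑ i : Fin m, (-(2 * A)) ≤ lap φ x := by
        refine Finset.sum_le_sum fun i _ => ?_
        have := (line_cond φ hφ A x y (EuclideanSpace.single i 1) hloc).2
        simp at this
        linarith
      simp at this
      linarith
    have hn : ‖gradient φ x‖ ^ θ ≤ (2 * A * r) ^ θ := by
      apply Real.rpow_le_rpow (norm_nonneg _) _ (by linarith)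
      rw [hgrad, norm_smul, norm_neg, Real.norm_of_nonneg (by positivity)]
      gcongr
    have h1 := hg x hxr
    rw [← heq x] at h1
    have : (1/θ) * ‖gradient φ x‖ ^ θ ≤ (1/θ) * (2 * A * r) ^ θ := by
      have : 0 < θ := by linarith
      gcongr
    linarith
  · rw [heq'] at hy
    linarith [hM x]

theorem stmt11 (m : ℕ) (hm : 1 ≤ m) (θ : ℝ) (hθ : 1 < θ)
    (α f₀ : ℝ) (hα : 0 < α) (hf₀ : 0 < f₀)
    (f : EuclideanSpace ℝ (Fin m) → ℝ) (hH0 : H0 f α f₀) (hH1 : H1 f α f₀)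
    (lam : ℝ) (φ : EuclideanSpace ℝ (Fin m) → ℝ) (hsol : IsSolution θ f lam φ)
    (hφ : BddBelow (Set.range φ)) :
    ∃ c > (0 : ℝ), ∀ y, c * ‖y‖ ^ (α / θ + 1) - c⁻¹ ≤ φ y := by
  obtain ⟨b, hb⟩ := hφ
  have hθ0 : 0 < θ := by linarith
  have hb' : ∀ y, -|b| ≤ φ y := fun y => (neg_abs_le b).trans (hb ⟨y, rfl⟩)
  set k : ℝ := f₀⁻¹ * (1/2) ^ α with hk
  have hk0 : 0 < k := by positivity
  set c : ℝ := min 1 (k / (4 * (m + 1))) with hc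
  have hc0 : 0 < c := by positivity
  have hc1 : c ≤ 1 := min_le_left _ _
  have hck : c * (m + 1) ≤ k / 4 := by
    have : c ≤ k / (4 * (m + 1)) := min_le_right _ _
    calc c * (m + 1) ≤ k / (4 * (m + 1)) * (m + 1) := by gcongr
      _ = k / 4 := by field_simp
  -- threshold radius
  set R0 : ℝ := max 1 ((2 * |lam| / k) ^ (1/α)) with hR0
  have hR01 : 1 ≤ R0 := le_max_left _ _
  have big : ∀ y : EuclideanSpace ℝ (Fin m), R0 ≤ ‖y‖ →
      (c / 4) * ‖y‖ ^ (α / θ + 1) - |b| ≤ φ y := by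
    intro y hy
    set R := ‖y‖ with hR
    have hR1 : 1 ≤ R := hR01.trans hy
    have hRp : 0 < R := by linarith
    have hRα : 2 * |lam| ≤ k * R ^ α := by
      have h1 : (2 * |lam| / k) ^ (1/α) ≤ R := (le_max_right _ _).trans hy
      have h2 := Real.rpow_le_rpow (by positivity) h1 hα.le
      rw [← Real.rpow_mul (by positivity), one_div_mul_cancel hα.ne', Real.rpow_one,
        div_le_iff₀ hk0] at h2
      linarith
    have hRα0 : 0 < R ^ α := by positivity
    have hmain := ball_comp θ hθ φ (fun y => f y - lam) hsol.1 hsol.2 |b|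
      (c * R ^ (α / θ - 1)) (R / 2) (by positivity) (by positivity) hb' y ?_
    · have : c * R ^ (α / θ - 1) * (R / 2) ^ 2 = c / 4 * R ^ (α / θ + 1) := by
        have : R ^ (α / θ + 1) = R ^ (α / θ - 1) * R ^ 2 := by
          rw [← Real.rpow_natCast, ← Real.rpow_add hRp]
          congr 1
          push_cast
          ring
        rw [this]; ring
      linarith
    · intro x hx
      have hxn : R / 2 ≤ ‖x‖ := by
        have := norm_sub_norm_le y x
        rw [norm_sub_rev] at this
        linarith
      have hfx : k * R ^ α < f x := by
        have h1 := (hH1 x).1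
        have h2 : (1/2 : ℝ) ^ α * R ^ α ≤ ‖x‖ ^ α := by
          rw [← Real.mul_rpow (by norm_num) hRp.le]
          exact Real.rpow_le_rpow (by positivity) (by linarith) hα.le
        have h3 : f₀⁻¹ * ((1/2 : ℝ) ^ α * R ^ α) ≤ f₀⁻¹ * ‖x‖ ^ α := by gcongr
        have h4 : 0 < f₀⁻¹ := by positivity
        rw [hk]
        linarith
      have hA : R ^ (α / θ - 1) ≤ R ^ α := by
        apply Real.rpow_le_rpow_of_exponent_le hR1
        have : α / θ ≤ α := div_le_self hα.le hθ.le
        linarith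
      have hpow : (2 * (c * R ^ (α / θ - 1)) * (R / 2)) ^ θ = c ^ θ * R ^ α := by
        have : 2 * (c * R ^ (α / θ - 1)) * (R / 2) = c * R ^ (α / θ) := by
          rw [Real.rpow_sub_one hRp.ne']; field_simp
        rw [this, Real.mul_rpow hc0.le (by positivity), ← Real.rpow_mul hRp.le,
          div_mul_cancel₀ _ hθ0.ne']
      have hcθ : c ^ θ ≤ c := by
        simpa using Real.rpow_le_rpow_of_exponent_ge hc0 hc1 hθ.le
      have h1θ : 1 / θ ≤ 1 := by rw [div_le_one hθ0]; exact hθ.le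
      rw [hpow]
      have e1 : (m:ℝ) * (c * R ^ (α / θ - 1)) ≤ m * (c * R ^ α) := by gcongr
      have e2 : 1 / θ * (c ^ θ * R ^ α) ≤ 1 * (c * R ^ α) := by gcongr
      have e3 : c * (m + 1) * R ^ α ≤ k / 4 * R ^ α := by gcongr
      have e4 : 0 < k * R ^ α := by positivity
      have := le_abs_self lam
      show _ < f x - lam
      linarith
  set B : ℝ := |b| + (c / 4) * R0 ^ (α / θ + 1) with hB
  have hB0 : 0 < B := by positivity
  have all : ∀ y : EuclideanSpace ℝ (Fin m), (c / 4) * ‖y‖ ^ (α / θ + 1) - B ≤ φ y := by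
    intro y
    rcases le_total R0 ‖y‖ with h | h
    · have := big y h
      have : 0 ≤ (c / 4) * R0 ^ (α / θ + 1) := by positivity
      linarith
    · have h1 : (c / 4) * ‖y‖ ^ (α / θ + 1) ≤ (c / 4) * R0 ^ (α / θ + 1) := by gcongr
      linarith [hb' y]
  refine ⟨min (c / 4) B⁻¹, by positivity, fun y => le_trans ?_ (all y)⟩
  have h1 : min (c / 4) B⁻¹ * ‖y‖ ^ (α / θ + 1) ≤ (c / 4) * ‖y‖ ^ (α / θ + 1) := by
    gcongr
    exact min_le_left _ _
  have h2 : B ≤ (min (c / 4) B⁻¹)⁻¹ := by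
    rw [le_inv_comm₀ hB0 (by positivity)]
    exact min_le_right _ _
  linarith
end

section
/- Let m ≥ 1, θ > 1, λ ∈ ℝ, and let f : ℝ^m → ℝ satisfy (H0) and (H1) with parameters α, f₀ > 0, and set γ = α/θ + 1. Let φ be a C² subsolution and ψ a C² supersolution of (EP)_λ with φ, ψ ∈ Φ_γ and ψ ≥ 1 on ℝ^m. Let R > 1 and q₀ > 1 be such that ψ^q is a strict supersolution of (EP)_λ on B_R^c for all q ∈ (1, q₀). If φ ≤ ψ on ∂B_R, then for every q ∈ (1, q₀), φ(y) ≤ ψ(y)^q for all y with |y| ≥ R. -/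
open Filter

theorem iter_two_nonpos {E : Type*} [NormedAddCommGroup E] [NormedSpace ℝ E]
    (u : E → ℝ) (hu : ContDiff ℝ 2 u) (y e : E) (hmax : IsLocalMax u y) :
    iteratedFDeriv ℝ 2 u y ![e, e] ≤ 0 := by
  by_contra hcon
  push Not at hcon
  set g : ℝ → ℝ := fun t => u (y + t • e) with hg
  have hline : ∀ t : ℝ, HasDerivAt (fun t : ℝ => y + t • e) e t := by
    intro t
    simpa using ((hasDerivAt_id t).smul_const e).const_add y
  have hdu : Differentiable ℝ u := hu.differentiable (by norm_num)
  have hddu : Differentiable ℝ (fderiv ℝ u) :=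
    (hu.fderiv_right (m := 1) (by norm_num)).differentiable (by norm_num)
  have hg1 : ∀ t, HasDerivAt g (fderiv ℝ u (y + t • e) e) t := by
    intro t
    exact (hdu (y + t • e)).hasFDerivAt.comp_hasDerivAt t (hline t)
  have hdg : deriv g = fun t => fderiv ℝ u (y + t • e) e := funext fun t => (hg1 t).deriv
  have hg2 : HasDerivAt (deriv g) (iteratedFDeriv ℝ 2 u y ![e, e]) 0 := by
    rw [hdg, iteratedFDeriv_two_apply]
    have h1 := (hddu (y + (0:ℝ) • e)).hasFDerivAt.comp_hasDerivAt 0 (hline 0)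
    have h2 := h1.clm_apply (hasDerivAt_const (0:ℝ) e)
    simpa using h2
  have hcont : ContinuousAt (fun t : ℝ => y + t • e) 0 := (hline 0).continuousAt
  have hgmax : IsLocalMax g 0 := by
    have : Filter.Tendsto (fun t : ℝ => y + t • e) (nhds 0) (nhds y) := by
      simpa [ContinuousAt] using hcont
    have h3 := this.eventually hmax
    filter_upwards [h3] with t ht
    simpa [hg] using ht
  have hgmin : IsLocalMin g 0 :=
    isLocalMin_of_deriv_deriv_pos (by rw [hg2.deriv]; exact hcon) hgmax.deriv_eq_zero
      (hg1 0).continuousAt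
  have heq : g =ᶠ[nhds 0] fun _ => g 0 := by
    filter_upwards [hgmax, hgmin] with t h1 h2
    exact le_antisymm h1 h2
  have h4 : deriv (deriv g) 0 = 0 := by
    rw [heq.deriv.deriv_eq]
    simp
  rw [hg2.deriv] at h4
  exact hcon.ne' h4

theorem stmt14 (m : ℕ) (hm : 1 ≤ m) (θ lam : ℝ) (hθ : 1 < θ)
    (α f₀ : ℝ) (hα : 0 < α) (hf₀ : 0 < f₀)
    (f : EuclideanSpace ℝ (Fin m) → ℝ) (hH0 : H0 f α f₀) (hH1 : H1 f α f₀)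
    (φ ψ : EuclideanSpace ℝ (Fin m) → ℝ)
    (hsub : IsSubsolution θ f lam φ) (hsuper : IsSupersolution θ f lam ψ)
    (hΦφ : MemPhi (α / θ + 1) φ) (hΦψ : MemPhi (α / θ + 1) ψ)
    (hψ1 : ∀ y, 1 ≤ ψ y)
    (R q₀ : ℝ) (hR : 1 < R) (hq₀ : 1 < q₀)
    (hstrict : ∀ q, 1 < q → q < q₀ → ∀ y, R ≤ ‖y‖ →
      -(1/2) * lap (fun x => ψ x ^ q) y
        + (1/θ) * ‖gradient (fun x => ψ x ^ q) y‖ ^ θ > f y - lam)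
    (hbdry : ∀ y, ‖y‖ = R → φ y ≤ ψ y) :
    ∀ q, 1 < q → q < q₀ → ∀ y, R ≤ ‖y‖ → φ y ≤ ψ y ^ q := by
  intro q hq1 hq2 y hy
  by_contra hcon
  push Not at hcon
  obtain ⟨hφc, hφ⟩ := hsub
  obtain ⟨hψc, -⟩ := hsuper
  obtain ⟨-, c₁, hc₁, hb₁⟩ := hΦφ
  obtain ⟨-, c₂, hc₂, hb₂⟩ := hΦψ
  have hpos : ∀ x, 0 < ψ x := fun x => lt_of_lt_of_le one_pos (hψ1 x)
  have hψq : ContDiff ℝ 2 (fun x => ψ x ^ q) :=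
    hψc.rpow_const_of_ne (fun x => (hpos x).ne')
  set u : EuclideanSpace ℝ (Fin m) → ℝ := fun x => φ x - ψ x ^ q with hu
  have huc : ContDiff ℝ 2 u := hφc.sub hψq
  have hγ : 0 < α / θ + 1 := by positivity
  have hψtop : Tendsto ψ (cocompact (EuclideanSpace ℝ (Fin m))) atTop := by
    refine tendsto_atTop_mono (fun x => (hb₂ x).1) ?_
    refine tendsto_atTop_add_const_right _ _ ?_
    refine Tendsto.const_mul_atTop (by positivity) ?_
    exact (tendsto_rpow_atTop hγ).comp (tendsto_norm_cocompact_atTop)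
  have hev : ∀ᶠ x in cocompact (EuclideanSpace ℝ (Fin m)), u x ≤ 0 := by
    have h1 : Tendsto (fun x => ψ x ^ (q - 1)) (cocompact (EuclideanSpace ℝ (Fin m))) atTop :=
      (tendsto_rpow_atTop (by linarith : 0 < q - 1)).comp hψtop
    filter_upwards [h1.eventually_ge_atTop (c₁ * c₂ + c₁ * (1 + c₂ * c₂))] with x hx
    have h2 : ψ x ^ q = ψ x ^ (q - 1) * ψ x := by
      rw [← Real.rpow_add_one (hpos x).ne']; ring_nf
    have h3 : ‖x‖ ^ (α / θ + 1) ≤ c₂ * (ψ x + c₂) := by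
      have h4 := (hb₂ x).1
      have h5 : c₂⁻¹ * ‖x‖ ^ (α / θ + 1) ≤ ψ x + c₂ := by linarith
      rwa [inv_mul_le_iff₀ (by linarith)] at h5
    have h6 : φ x ≤ c₁ * (1 + c₂ * (ψ x + c₂)) := by
      refine (hb₁ x).2.trans ?_
      gcongr
    have h7 : (c₁ * c₂ + c₁ * (1 + c₂ * c₂)) * ψ x ≤ ψ x ^ (q - 1) * ψ x :=
      mul_le_mul_of_nonneg_right hx (hpos x).le
    have h8 : c₁ * (1 + c₂ * c₂) * 1 ≤ c₁ * (1 + c₂ * c₂) * ψ x :=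
      mul_le_mul_of_nonneg_left (hψ1 x) (by positivity)
    simp only [hu]
    rw [h2]
    linarith
  have hclosed : IsClosed {x : EuclideanSpace ℝ (Fin m) | R ≤ ‖x‖} :=
    isClosed_le continuous_const continuous_norm
  have huy : 0 < u y := by simp only [hu]; linarith
  obtain ⟨z, hz, hzmax⟩ := huc.continuous.continuousOn.exists_isMaxOn' hclosed hy
    (Filter.Eventually.filter_mono inf_le_left (hev.mono fun x hx => hx.trans huy.le))
  have huz : 0 < u z := lt_of_lt_of_le huy (hzmax hy)
  have hzR : R < ‖z‖ := by
    refine lt_of_le_of_ne hz fun h => ?_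
    have h1 := hbdry z h.symm
    have h2 : ψ z ≤ ψ z ^ q := Real.self_le_rpow_of_one_le (hψ1 z) hq1.le
    simp only [hu] at huz
    linarith
  have hloc : IsLocalMax u z := by
    refine hzmax.isLocalMax ?_
    filter_upwards [(isOpen_lt continuous_const continuous_norm).mem_nhds hzR] with x hx
    exact le_of_lt hx
  have hgrad : gradient φ z = gradient (fun x => ψ x ^ q) z := by
    have h1 := hloc.fderiv_eq_zero
    have h2 : fderiv ℝ u z = fderiv ℝ φ z - fderiv ℝ (fun x => ψ x ^ q) z :=
      fderiv_fun_sub (hφc.differentiable (by norm_num) z) (hψq.differentiable (by norm_num) z)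
    rw [h2, sub_eq_zero] at h1
    simp only [gradient, h1]
  have hlap : lap φ z ≤ lap (fun x => ψ x ^ q) z := by
    refine Finset.sum_le_sum fun i _ => ?_
    have h1 := iter_two_nonpos u huc z (EuclideanSpace.single i 1) hloc
    have h2 : iteratedFDeriv ℝ 2 u z = iteratedFDeriv ℝ 2 φ z
        - iteratedFDeriv ℝ 2 (fun x => ψ x ^ q) z :=
      iteratedFDeriv_sub_apply hφc.contDiffAt hψq.contDiffAt
    rw [h2] at h1
    simp only [sub_apply] at h1
    linarith
  have h1 := hφ z
  have h2 := hstrict q hq1 hq2 z hz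
  rw [hgrad] at h1
  linarith
end

section
/- Let m ≥ 1, θ > 1, λ ∈ ℝ, and let f : ℝ^m → ℝ satisfy (H0) and (H1) with parameters α, f₀ > 0, and set γ = α/θ + 1. Let φ be a C² subsolution and ψ a C² supersolution of (EP)_λ with φ, ψ ∈ Φ_γ and ψ ≥ 1 on ℝ^m. Let R > 1 and q₀ > 1 be such that ψ^q is a strict supersolution of (EP)_λ on B_R^c for all q ∈ (1, q₀). If φ ≤ ψ on ∂B_R, then φ(y) ≤ ψ(y) for all y with |y| ≥ R. -/
open Filter

theorem aux_second_deriv {m : ℕ} (u : EuclideanSpace ℝ (Fin m) → ℝ) (hu : ContDiff ℝ 2 u)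
    (y e : EuclideanSpace ℝ (Fin m)) (hmax : IsLocalMax u y) :
    iteratedFDeriv ℝ 2 u y ![e, e] ≤ 0 := by
  have hline : ∀ t : ℝ, HasDerivAt (fun t : ℝ => y + t • e) e t := by
    intro t
    simpa using ((hasDerivAt_id t).smul_const e).const_add y
  have hd1 : ∀ t : ℝ, HasDerivAt (fun t : ℝ => u (y + t • e)) (fderiv ℝ u (y + t • e) e) t := by
    intro t
    have h1 : HasFDerivAt u (fderiv ℝ u (y + t • e)) (y + t • e) :=
      ((hu.differentiable (by norm_num)) _).hasFDerivAt
    exact h1.comp_hasDerivAt t (hline t)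
  have hderiv : deriv (fun t : ℝ => u (y + t • e)) = fun t => fderiv ℝ u (y + t • e) e :=
    funext fun t => (hd1 t).deriv
  have hfd : ContDiff ℝ 1 (fderiv ℝ u) := hu.fderiv_right (by norm_num)
  have hd2 : HasDerivAt (fun t : ℝ => fderiv ℝ u (y + t • e) e)
      (fderiv ℝ (fderiv ℝ u) y e e) 0 := by
    have h1 : HasFDerivAt (fderiv ℝ u) (fderiv ℝ (fderiv ℝ u) y) (y + (0:ℝ) • e) := by
      rw [zero_smul, add_zero]
      exact ((hfd.differentiable (by norm_num)) _).hasFDerivAt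
    have h2 := h1.comp_hasDerivAt (0:ℝ) (hline 0)
    simpa using h2.clm_apply (hasDerivAt_const (0:ℝ) e)
  rw [iteratedFDeriv_two_apply]
  simp only [Matrix.cons_val_zero, Matrix.cons_val_one]
  by_contra hcon
  push Not at hcon
  have hcont : ContinuousAt (fun t : ℝ => y + t • e) 0 := (hline 0).continuousAt
  have hmax0 : IsLocalMax (fun t : ℝ => u (y + t • e)) 0 := by
    have : Filter.Tendsto (fun t : ℝ => y + t • e) (nhds 0) (nhds y) := by
      simpa [ContinuousAt] using hcont
    have h3 := this.eventually hmax
    show ∀ᶠ t in nhds (0:ℝ), u (y + t • e) ≤ u (y + (0:ℝ) • e)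
    simpa using h3
  have hdd : deriv (deriv (fun t : ℝ => u (y + t • e))) 0 = fderiv ℝ (fderiv ℝ u) y e e := by
    rw [hderiv]; exact hd2.deriv
  have hmin0 : IsLocalMin (fun t : ℝ => u (y + t • e)) 0 :=
    isLocalMin_of_deriv_deriv_pos (by rw [hdd]; exact hcon) hmax0.deriv_eq_zero
      (hd1 0).continuousAt
  have heq : (fun t : ℝ => u (y + t • e)) =ᶠ[nhds 0] fun _ => u (y + (0:ℝ) • e) := by
    filter_upwards [hmax0, hmin0] with t h1 h2
    exact le_antisymm h1 h2
  have h4 := heq.deriv.deriv_eq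
  rw [hdd] at h4
  simp at h4
  linarith

theorem aux_growth {m : ℕ} (γ q : ℝ) (hγ : 1 ≤ γ) (hq : 1 < q)
    (φ ψ : EuclideanSpace ℝ (Fin m) → ℝ) (hφ : MemPhi γ φ) (hψ : MemPhi γ ψ)
    (hψ1 : ∀ y, 1 ≤ ψ y) : ∃ r : ℝ, ∀ y, r ≤ ‖y‖ → φ y ≤ ψ y ^ q := by
  obtain ⟨-, c, hc, hφ⟩ := hφ
  obtain ⟨-, d, hd, hψ⟩ := hψ
  set K := c * (1 + d + d ^ 2) with hK
  have hKpos : 0 < K := by positivity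
  set L := K ^ (q - 1)⁻¹ with hL
  have hLpos : 0 < L := Real.rpow_pos_of_pos hKpos _
  refine ⟨max 1 (d * (L + d)), fun y hy => ?_⟩
  have hy1 : 1 ≤ ‖y‖ := le_trans (le_max_left _ _) hy
  have hy2 : d * (L + d) ≤ ‖y‖ := le_trans (le_max_right _ _) hy
  have hs : ‖y‖ ≤ ‖y‖ ^ γ := by
    simpa using Real.rpow_le_rpow_of_exponent_le hy1 hγ
  have h1 := (hφ y).2
  have h2 := (hψ y).1
  set s := ‖y‖ ^ γ
  have h3 : s ≤ d * (ψ y + d) := by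
    have : d⁻¹ * s ≤ ψ y + d := by linarith
    rwa [inv_mul_le_iff₀ (by linarith)] at this
  have hLψ : L ≤ ψ y := by
    have : d * (L + d) ≤ d * (ψ y + d) := by linarith
    have := le_of_mul_le_mul_left this (by linarith)
    linarith
  have hKψ : K ≤ ψ y ^ (q - 1) := by
    calc K = L ^ (q - 1) := by
          rw [hL, ← Real.rpow_mul hKpos.le, inv_mul_cancel₀ (by linarith), Real.rpow_one]
      _ ≤ _ := Real.rpow_le_rpow hLpos.le hLψ (by linarith)
  have hp : 0 < ψ y := by linarith [hψ1 y]
  have h5 : ψ y ^ q = ψ y ^ (q - 1) * ψ y := by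
    rw [← Real.rpow_add_one hp.ne']; congr 1; ring
  rw [h5]
  refine le_trans h1 (le_trans ?_ (mul_le_mul_of_nonneg_right hKψ hp.le))
  rw [hK, mul_assoc]
  refine mul_le_mul_of_nonneg_left ?_ (by linarith)
  nlinarith [hψ1 y, mul_nonneg (sq_nonneg d) (sub_nonneg.2 (hψ1 y))]

theorem stmt15 (m : ℕ) (hm : 1 ≤ m) (θ lam : ℝ) (hθ : 1 < θ)
    (α f₀ : ℝ) (hα : 0 < α) (hf₀ : 0 < f₀)
    (f : EuclideanSpace ℝ (Fin m) → ℝ) (hH0 : H0 f α f₀) (hH1 : H1 f α f₀)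
    (φ ψ : EuclideanSpace ℝ (Fin m) → ℝ)
    (hsub : IsSubsolution θ f lam φ) (hsuper : IsSupersolution θ f lam ψ)
    (hΦφ : MemPhi (α / θ + 1) φ) (hΦψ : MemPhi (α / θ + 1) ψ)
    (hψ1 : ∀ y, 1 ≤ ψ y)
    (R q₀ : ℝ) (hR : 1 < R) (hq₀ : 1 < q₀)
    (hstrict : ∀ q, 1 < q → q < q₀ → ∀ y, R ≤ ‖y‖ →
      -(1/2) * lap (fun x => ψ x ^ q) y
        + (1/θ) * ‖gradient (fun x => ψ x ^ q) y‖ ^ θ > f y - lam)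
    (hbdry : ∀ y, ‖y‖ = R → φ y ≤ ψ y) :
    ∀ y, R ≤ ‖y‖ → φ y ≤ ψ y := by
  have hγ : 1 ≤ α / θ + 1 := by
    have : 0 < α / θ := div_pos hα (by linarith)
    linarith
  have key : ∀ q, 1 < q → q < q₀ → ∀ y, R ≤ ‖y‖ → φ y ≤ ψ y ^ q := by
    intro q hq hqq y₁ hy₁
    by_contra hcon
    push Not at hcon
    obtain ⟨r, hr⟩ := aux_growth _ q hγ hq φ ψ hΦφ hΦψ hψ1
    have hg : ContDiff ℝ 2 (fun x => ψ x ^ q) :=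
      hΦψ.1.rpow_const_of_ne (fun x => by linarith [hψ1 x])
    set g : EuclideanSpace ℝ (Fin m) → ℝ := fun x => ψ x ^ q with hgdef
    set M := max r ‖y₁‖ with hM
    have hcpt : IsCompact (Metric.closedBall (0 : EuclideanSpace ℝ (Fin m)) M ∩ {y | R ≤ ‖y‖}) :=
      (isCompact_closedBall _ _).inter_right (isClosed_le continuous_const continuous_norm)
    have hu : ContDiff ℝ 2 (φ - g) := hsub.1.sub hg
    obtain ⟨y₀, ⟨hy₀M, hy₀R⟩, hy₀⟩ := hcpt.exists_isMaxOn
      ⟨y₁, by simp [hM], hy₁⟩ hu.continuous.continuousOn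
    have hpos : 0 < (φ - g) y₀ := by
      have h1 : (φ - g) y₁ ≤ (φ - g) y₀ := hy₀ ⟨by simp [hM], hy₁⟩
      have h2 : 0 < (φ - g) y₁ := by simp [hgdef]; linarith
      linarith
    have hpos' : g y₀ < φ y₀ := by simpa using hpos
    have hψg : ψ y₀ ≤ g y₀ := by
      simpa using Real.rpow_le_rpow_of_exponent_le (hψ1 y₀) hq.le
    have hne : R < ‖y₀‖ := by
      rcases lt_or_eq_of_le (show R ≤ ‖y₀‖ from hy₀R) with h | h
      · exact h
      · linarith [hbdry y₀ h.symm]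
    have hlt : ‖y₀‖ < M := by
      by_contra h
      have : φ y₀ ≤ g y₀ := hr y₀ (le_trans (le_max_left _ _) (not_lt.1 h))
      linarith
    have hloc : IsLocalMax (φ - g) y₀ := by
      have ho : IsOpen {y : EuclideanSpace ℝ (Fin m) | R < ‖y‖ ∧ ‖y‖ < M} :=
        (isOpen_lt continuous_const continuous_norm).inter
          (isOpen_lt continuous_norm continuous_const)
      filter_upwards [ho.mem_nhds ⟨hne, hlt⟩] with y hy
      exact hy₀ ⟨by simpa using hy.2.le, hy.1.le⟩
    have hgrad : gradient φ y₀ = gradient g y₀ := by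
      have h1 := hloc.fderiv_eq_zero
      rw [fderiv_sub (hsub.1.differentiable (by norm_num) _)
        (hg.differentiable (by norm_num) _)] at h1
      simp only [gradient, sub_eq_zero.1 h1]
    have hlap : lap φ y₀ ≤ lap g y₀ := by
      refine Finset.sum_le_sum fun i _ => ?_
      have h1 := aux_second_deriv _ hu y₀ (EuclideanSpace.single i 1) hloc
      rw [iteratedFDeriv_sub (i := 2) hsub.1 hg] at h1
      simpa using h1
    have h1 := hstrict q hq hqq y₀ hy₀R
    have h2 := hsub.2 y₀
    rw [hgrad] at h2
    linarith
  intro y hy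
  have ht : Filter.Tendsto (fun q : ℝ => ψ y ^ q) (nhdsWithin 1 (Set.Ioi 1)) (nhds (ψ y)) := by
    have : ContinuousAt (fun q : ℝ => ψ y ^ q) 1 :=
      Real.continuousAt_const_rpow (by linarith [hψ1 y])
    have h := this.tendsto.mono_left (nhdsWithin_le_nhds (s := Set.Ioi 1))
    simpa using h
  refine ge_of_tendsto ht ?_
  filter_upwards [Ioo_mem_nhdsGT hq₀] with q hq
  exact key q hq.1 hq.2 y hy
end
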